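/- Fix an integer n ≥ 3, 0 < ρ < 1, and set δ = ((n-2)/n)ρ. Define, for t ∈ [-1,1]: F(t) := ∫_{-1}^{1} |δt-x|(1-x²)^{(n-3)/2} dx, G(t) := (n-2)ρt ∫_{-1}^{1} |δt-x|(1-x²)^{(n-3)/2} x dx, and H(t) := (2/(n²-1))(1-δ²t²)^{(n+1)/2} Σ_{k=2}^{∞} ((k-2)!/(n+2)_{k-2}) C_{k-2}^{(n+2)/2}(δt) C_k^{(n-2)/2}(t) ρ^k. Then the function F + G + H is convex on [-1,1]. -/

import Mathlib

open scoped Real BigOperators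

/-- Pochhammer symbol `(lam)_m`. -/
noncomputable def poch (lam : ℝ) (m : ℕ) : ℝ := (ascPochhammer ℝ m).eval lam

/-- Gegenbauer polynomial `C_k^lam(x)`, via its explicit representation. -/
noncomputable def gegen (lam : ℝ) (k : ℕ) (x : ℝ) : ℝ :=
  ∑ j ∈ Finset.range (k / 2 + 1),
    (-1 : ℝ) ^ j * poch lam (k - j) / ((Nat.factorial j : ℝ) * (Nat.factorial (k - 2 * j) : ℝ))
      * (2 * x) ^ (k - 2 * j)

/-! ### Algebraic identities for Gegenbauer polynomials -/

lemma poch_zero (a : ℝ) : poch a 0 = 1 := by simp [poch]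

lemma poch_succ (a : ℝ) (m : ℕ) : poch a (m + 1) = poch a m * (a + m) := by
  simp [poch, ascPochhammer_succ_eval]

lemma poch_succ_left (a : ℝ) (m : ℕ) : poch a (m + 1) = a * poch (a + 1) m := by
  simp [poch, ascPochhammer_succ_left, Polynomial.eval_comp]

lemma poch_pos {a : ℝ} (ha : 0 < a) (m : ℕ) : 0 < poch a m := ascPochhammer_pos m a ha

/-- The `j`-th term of the explicit representation of `gegen`, extended by zero. -/
noncomputable def gegenTerm (μ : ℝ) (k j : ℕ) (x : ℝ) : ℝ :=
  if 2 * j ≤ k then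
    (-1 : ℝ) ^ j * poch μ (k - j) / ((Nat.factorial j : ℝ) * (Nat.factorial (k - 2 * j) : ℝ))
      * (2 * x) ^ (k - 2 * j)
  else 0

lemma gegenTerm_of_lt {μ : ℝ} {k j : ℕ} (h : k < 2 * j) (x : ℝ) : gegenTerm μ k j x = 0 :=
  if_neg (by omega)

lemma gegenTerm_add (μ : ℝ) (m j : ℕ) (x : ℝ) :
    gegenTerm μ (m + 2 * j) j x =
      (-1 : ℝ) ^ j * poch μ (m + j) / ((Nat.factorial j : ℝ) * (Nat.factorial m : ℝ))
        * (2 * x) ^ m := by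
  rw [gegenTerm, if_pos (by omega), show m + 2 * j - j = m + j by omega,
    show m + 2 * j - 2 * j = m by omega]

lemma gegen_eq_sum (μ : ℝ) {k M : ℕ} (h : k / 2 + 1 ≤ M) (x : ℝ) :
    gegen μ k x = ∑ j ∈ Finset.range M, gegenTerm μ k j x := by
  rw [gegen, ← Finset.sum_subset (Finset.range_mono h)]
  · refine Finset.sum_congr rfl fun j hj => ?_
    rw [Finset.mem_range] at hj
    rw [gegenTerm, if_pos (by omega)]
  · intro j _ hj
    rw [Finset.mem_range] at hj
    exact gegenTerm_of_lt (by omega) x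

lemma gegen_zero (μ x : ℝ) : gegen μ 0 x = 1 := by simp [gegen, poch_zero]

lemma gegen_one (μ x : ℝ) : gegen μ 1 x = 2 * μ * x := by
  simp [gegen, poch_succ, poch_zero]; ring

lemma gegen_neg (μ : ℝ) (k : ℕ) (x : ℝ) : gegen μ k (-x) = (-1) ^ k * gegen μ k x := by
  rw [gegen, gegen, Finset.mul_sum]
  refine Finset.sum_congr rfl fun j hj => ?_
  rw [Finset.mem_range] at hj
  obtain ⟨m, rfl⟩ : ∃ m, k = m + 2 * j := ⟨k - 2 * j, by omega⟩
  rw [show m + 2 * j - 2 * j = m by omega, mul_neg, neg_pow (2 * x) m, pow_add, pow_mul]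
  norm_num
  ring

lemma gegenTerm_rec_zero (μ : ℝ) (k : ℕ) (x : ℝ) :
    ((k : ℝ) + 2) * gegenTerm μ (k + 2) 0 x
      = 2 * x * ((k : ℝ) + 1 + μ) * gegenTerm μ (k + 1) 0 x := by
  have h1 := gegenTerm_add μ (k + 2) 0 x
  have h2 := gegenTerm_add μ (k + 1) 0 x
  simp only [mul_zero, add_zero] at h1 h2
  rw [h1, h2, poch_succ μ (k + 1), Nat.factorial_succ (k + 1)]
  have : ((k + 1).factorial : ℝ) ≠ 0 := by positivity
  push_cast
  field_simp
  ring

lemma gegenTerm_rec_succ (μ : ℝ) (k j : ℕ) (x : ℝ) :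
    ((k : ℝ) + 2) * gegenTerm μ (k + 2) (j + 1) x
      = 2 * x * ((k : ℝ) + 1 + μ) * gegenTerm μ (k + 1) (j + 1) x
        - ((k : ℝ) + 2 * μ) * gegenTerm μ k j x := by
  rcases lt_or_ge k (2 * j) with h | h
  · simp [gegenTerm_of_lt (show k + 2 < 2 * (j + 1) by omega),
      gegenTerm_of_lt (show k + 1 < 2 * (j + 1) by omega), gegenTerm_of_lt h]
  obtain ⟨m, rfl⟩ : ∃ m, k = m + 2 * j := ⟨k - 2 * j, by omega⟩
  have hj : (j.factorial : ℝ) ≠ 0 := by positivity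
  rcases m with _ | m
  · rw [gegenTerm_of_lt (show 0 + 2 * j + 1 < 2 * (j + 1) by omega),
      show 0 + 2 * j + 2 = 0 + 2 * (j + 1) by ring, gegenTerm_add, gegenTerm_add,
      show 0 + (j + 1) = (0 + j) + 1 by ring, poch_succ, Nat.factorial_succ]
    push_cast
    field_simp
    ring
  · have hm : (m.factorial : ℝ) ≠ 0 := by positivity
    rw [show m + 1 + 2 * j + 2 = (m + 1) + 2 * (j + 1) by ring,
      show m + 1 + 2 * j + 1 = m + 2 * (j + 1) by ring, gegenTerm_add, gegenTerm_add,
      gegenTerm_add, show m + 1 + (j + 1) = (m + (j + 1)) + 1 by ring, poch_succ,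
      show m + 1 + j = m + (j + 1) by ring,
      Nat.factorial_succ, Nat.factorial_succ]
    push_cast
    field_simp
    ring

lemma gegen_rec (μ : ℝ) (k : ℕ) (x : ℝ) :
    ((k : ℝ) + 2) * gegen μ (k + 2) x
      = 2 * x * ((k : ℝ) + 1 + μ) * gegen μ (k + 1) x - ((k : ℝ) + 2 * μ) * gegen μ k x := by
  have h2 := gegen_eq_sum μ (show (k + 2) / 2 + 1 ≤ k + 2 + 1 by omega) x
  have h1 := gegen_eq_sum μ (show (k + 1) / 2 + 1 ≤ k + 2 + 1 by omega) x
  rw [Finset.sum_range_succ'] at h1 h2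
  rw [h2, h1, gegen_eq_sum μ (show k / 2 + 1 ≤ k + 2 by omega), mul_add, mul_add,
    gegenTerm_rec_zero, Finset.mul_sum, Finset.mul_sum, Finset.mul_sum]
  simp only [gegenTerm_rec_succ, Finset.sum_sub_distrib]
  ring

lemma gegenTerm_ode_zero (μ : ℝ) (k : ℕ) (x : ℝ) :
    ((k : ℝ) + 2) * (k + 2 + 2 * μ) * gegenTerm μ (k + 2) 0 x
      = x ^ 2 * (4 * μ * (μ + 1)) * gegenTerm (μ + 2) k 0 x
        + 2 * μ * (2 * μ + 1) * x * gegenTerm (μ + 1) (k + 1) 0 x := by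
  have h1 := gegenTerm_add μ (k + 2) 0 x
  have h2 := gegenTerm_add (μ + 1) (k + 1) 0 x
  have h3 := gegenTerm_add (μ + 2) k 0 x
  simp only [mul_zero, add_zero] at h1 h2 h3
  rw [h1, h2, h3, poch_succ_left μ (k + 1), poch_succ_left (μ + 1) k, Nat.factorial_succ (k + 1),
    Nat.factorial_succ k, show μ + 1 + 1 = μ + 2 by ring]
  have : (k.factorial : ℝ) ≠ 0 := by positivity
  push_cast
  field_simp
  ring

lemma gegenTerm_ode_succ (μ : ℝ) (k j : ℕ) (x : ℝ) :
    ((k : ℝ) + 2) * (k + 2 + 2 * μ) * gegenTerm μ (k + 2) (j + 1) x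
      = x ^ 2 * (4 * μ * (μ + 1)) * gegenTerm (μ + 2) k (j + 1) x
        + 2 * μ * (2 * μ + 1) * x * gegenTerm (μ + 1) (k + 1) (j + 1) x
        - 4 * μ * (μ + 1) * gegenTerm (μ + 2) k j x := by
  rcases lt_or_ge k (2 * j) with h | h
  · simp [gegenTerm_of_lt (show k + 2 < 2 * (j + 1) by omega),
      gegenTerm_of_lt (show k + 1 < 2 * (j + 1) by omega), gegenTerm_of_lt h,
      gegenTerm_of_lt (show k < 2 * (j + 1) by omega)]
  obtain ⟨m, rfl⟩ : ∃ m, k = m + 2 * j := ⟨k - 2 * j, by omega⟩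
  have hj : (j.factorial : ℝ) ≠ 0 := by positivity
  have e2 : ∀ i, poch μ (i + 2) = μ * (μ + 1) * poch (μ + 2) i := fun i => by
    rw [poch_succ_left, poch_succ_left, show μ + 1 + 1 = μ + 2 by ring, mul_assoc]
  have e1 : ∀ i, poch (μ + 1) (i + 1) = (μ + 1) * poch (μ + 2) i := fun i => by
    rw [poch_succ_left, show μ + 1 + 1 = μ + 2 by ring]
  rcases m with _ | _ | m
  · rw [gegenTerm_of_lt (show 0 + 2 * j + 1 < 2 * (j + 1) by omega),
      gegenTerm_of_lt (show 0 + 2 * j < 2 * (j + 1) by omega),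
      show 0 + 2 * j + 2 = 0 + 2 * (j + 1) by ring, gegenTerm_add, gegenTerm_add,
      show 0 + (j + 1) = j + 1 by ring, show 0 + j = j by ring]
    have := poch_succ μ (j + 1)
    rw [e2] at this
    have key : poch μ (j + 1) * (μ + (j + 1)) = μ * (μ + 1) * poch (μ + 2) j := by
      rw [this]; push_cast; ring
    rw [Nat.factorial_succ]
    push_cast
    field_simp
    linear_combination (-4 * (-1 : ℝ) ^ j * ((j : ℝ) + 1)) * key
  · rw [gegenTerm_of_lt (show 0 + 1 + 2 * j < 2 * (j + 1) by omega),
      show 0 + 1 + 2 * j + 2 = 1 + 2 * (j + 1) by ring,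
      show 0 + 1 + 2 * j + 1 = 0 + 2 * (j + 1) by ring,
      gegenTerm_add, gegenTerm_add, gegenTerm_add,
      show 1 + (j + 1) = j + 2 by ring, show 0 + (j + 1) = j + 1 by ring,
      show 0 + 1 + j = j + 1 by ring, e2, e1, poch_succ (μ + 2) j, Nat.factorial_succ]
    push_cast
    field_simp
    ring
  · have hm : (m.factorial : ℝ) ≠ 0 := by positivity
    rw [show m + 1 + 1 + 2 * j + 2 = (m + 2) + 2 * (j + 1) by ring,
      show m + 1 + 1 + 2 * j + 1 = (m + 1) + 2 * (j + 1) by ring,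
      gegenTerm_add, gegenTerm_add, gegenTerm_add,
      show m + 1 + 1 + 2 * j = m + 2 * (j + 1) by ring, gegenTerm_add,
      show m + 2 + (j + 1) = (m + j + 1) + 2 by ring,
      show m + 1 + (j + 1) = (m + j + 1) + 1 by ring, 
      show m + (j + 1) = m + j + 1 by ring,
      show m + 1 + 1 + j = m + j + 1 + 1 by ring, e2, e1, poch_succ (μ + 2) (m + j + 1),
      Nat.factorial_succ j, Nat.factorial_succ (m + 1), Nat.factorial_succ m]
    push_cast
    field_simp
    ring

/-- The Gegenbauer differential equation, with derivatives written as Gegenbauer polynomials. -/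
lemma gegen_ode (μ : ℝ) (k : ℕ) (x : ℝ) :
    (1 - x ^ 2) * (4 * μ * (μ + 1) * gegen (μ + 2) k x)
      - (2 * μ + 1) * x * (2 * μ * gegen (μ + 1) (k + 1) x)
      + ((k : ℝ) + 2) * (k + 2 + 2 * μ) * gegen μ (k + 2) x = 0 := by
  have key : ((k : ℝ) + 2) * (k + 2 + 2 * μ) * gegen μ (k + 2) x
      = x ^ 2 * (4 * μ * (μ + 1)) * gegen (μ + 2) k x
        + 2 * μ * (2 * μ + 1) * x * gegen (μ + 1) (k + 1) x
        - 4 * μ * (μ + 1) * gegen (μ + 2) k x := by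
    have h2 := gegen_eq_sum μ (show (k + 2) / 2 + 1 ≤ k + 2 + 1 by omega) x
    have h1 := gegen_eq_sum (μ + 1) (show (k + 1) / 2 + 1 ≤ k + 2 + 1 by omega) x
    have h0 := gegen_eq_sum (μ + 2) (show k / 2 + 1 ≤ k + 2 + 1 by omega) x
    have h0' := gegen_eq_sum (μ + 2) (show k / 2 + 1 ≤ k + 2 by omega) x
    rw [Finset.sum_range_succ'] at h0 h1 h2
    have h4 : 4 * μ * (μ + 1) * gegen (μ + 2) k x
        = ∑ j ∈ Finset.range (k + 2), 4 * μ * (μ + 1) * gegenTerm (μ + 2) k j x := by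
      rw [h0', Finset.mul_sum]
    have hs : ((k : ℝ) + 2) * (k + 2 + 2 * μ)
          * ∑ j ∈ Finset.range (k + 2), gegenTerm μ (k + 2) (j + 1) x
        = x ^ 2 * (4 * μ * (μ + 1)) * ∑ j ∈ Finset.range (k + 2), gegenTerm (μ + 2) k (j + 1) x
          + 2 * μ * (2 * μ + 1) * x
            * ∑ j ∈ Finset.range (k + 2), gegenTerm (μ + 1) (k + 1) (j + 1) x
          - ∑ j ∈ Finset.range (k + 2), 4 * μ * (μ + 1) * gegenTerm (μ + 2) k j x := by
      rw [Finset.mul_sum, Finset.mul_sum, Finset.mul_sum, ← Finset.sum_add_distrib,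
        ← Finset.sum_sub_distrib]
      exact Finset.sum_congr rfl fun j _ => gegenTerm_ode_succ μ k j x
    rw [h4, h2, h1, h0]
    linear_combination hs + gegenTerm_ode_zero μ k x
  rw [key]; ring

lemma hasDerivAt_gegenTerm (μ : ℝ) (k j : ℕ) (x : ℝ) :
    HasDerivAt (gegenTerm μ (k + 1) j) (2 * μ * gegenTerm (μ + 1) k j x) x := by
  rcases lt_or_ge k (2 * j) with h | h
  · rw [gegenTerm_of_lt h, mul_zero]
    rcases lt_or_eq_of_le (show k + 1 ≤ 2 * j by omega) with h' | h'
    · rw [show gegenTerm μ (k + 1) j = fun _ => (0 : ℝ) from funext (gegenTerm_of_lt h')]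
      exact hasDerivAt_const _ _
    · have : gegenTerm μ (k + 1) j = fun _ => gegenTerm μ (k + 1) j 0 := by
        ext y
        rw [show k + 1 = 0 + 2 * j by omega, gegenTerm_add, gegenTerm_add]
        simp
      rw [this]
      exact hasDerivAt_const _ _
  obtain ⟨m, rfl⟩ : ∃ m, k = m + 2 * j := ⟨k - 2 * j, by omega⟩
  have : gegenTerm μ (m + 2 * j + 1) j = fun y =>
      (-1 : ℝ) ^ j * poch μ (m + 1 + j) / ((Nat.factorial j : ℝ) * (Nat.factorial (m + 1) : ℝ))
        * (2 * y) ^ (m + 1) := by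
    ext y
    rw [show m + 2 * j + 1 = (m + 1) + 2 * j by ring, gegenTerm_add]
  rw [this, gegenTerm_add]
  have hd : HasDerivAt (fun y : ℝ => (2 * y) ^ (m + 1)) (((m + 1 : ℕ) : ℝ) * (2 * x) ^ m * 2) x := by
    have := ((hasDerivAt_id x).const_mul 2).fun_pow (m + 1)
    simpa using this
  refine (hd.const_mul _).congr_deriv ?_
  have hm : (m.factorial : ℝ) ≠ 0 := by positivity
  have hj : (j.factorial : ℝ) ≠ 0 := by positivity
  rw [show m + 1 + j = m + j + 1 by ring, poch_succ_left, Nat.factorial_succ]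
  push_cast
  field_simp

lemma hasDerivAt_gegen_succ (μ : ℝ) (k : ℕ) (x : ℝ) :
    HasDerivAt (gegen μ (k + 1)) (2 * μ * gegen (μ + 1) k x) x := by
  have h1 : gegen μ (k + 1) = fun y => ∑ j ∈ Finset.range (k + 2), gegenTerm μ (k + 1) j y :=
    funext fun y => gegen_eq_sum μ (by omega) y
  rw [h1, gegen_eq_sum (μ + 1) (show k / 2 + 1 ≤ k + 2 by omega), Finset.mul_sum]
  exact HasDerivAt.fun_sum fun j _ => hasDerivAt_gegenTerm μ k j x

lemma continuous_gegen (μ : ℝ) (k : ℕ) : Continuous (gegen μ k) := by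
  unfold gegen; fun_prop

lemma gegen_at_one {μ : ℝ} (hμ : 0 < μ) (k : ℕ) :
    gegen μ k 1 = poch (2 * μ) k / (k.factorial : ℝ) := by
  induction k using Nat.strong_induction_on generalizing μ with
  | _ k ih =>
    rcases k with _ | _ | k
    · simp [gegen_zero, poch_zero]
    · simp [gegen_one, poch_succ, poch_zero]
    · have h := gegen_ode μ k 1
      have hk := ih (k + 1) (by omega) (show 0 < μ + 1 by linarith)
      rw [hk, Nat.factorial_succ] at h
      rw [Nat.factorial_succ, Nat.factorial_succ, poch_succ_left, poch_succ_left]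
      have e : poch (2 * (μ + 1)) (k + 1) = poch (2 * μ + 1 + 1) k * (2 * μ + 2 + k) := by
        rw [poch_succ]; ring_nf
      rw [e] at h
      generalize poch (2 * μ + 1 + 1) k = p at h ⊢
      have hk' : (k.factorial : ℝ) ≠ 0 := by positivity
      have h3 : (k : ℝ) + 2 + 2 * μ ≠ 0 := by positivity
      rw [eq_div_iff (by positivity)]
      push_cast at h ⊢
      field_simp at h
      apply mul_left_cancel₀ h3
      linear_combination h

/-! ### Bounds and the product formula -/

lemma exists_gegen_derivs {μ : ℝ} {k : ℕ} (hk : k ≠ 0) :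
    ∃ g₁ g₂ : ℝ → ℝ, (∀ x, HasDerivAt (gegen μ k) (g₁ x) x) ∧ (∀ x, HasDerivAt g₁ (g₂ x) x) ∧
      Continuous g₂ ∧ ∀ x, (1 - x ^ 2) * g₂ x - (2 * μ + 1) * x * g₁ x
        + (k : ℝ) * (k + 2 * μ) * gegen μ k x = 0 := by
  rcases k with _ | _ | k
  · exact absurd rfl hk
  · refine ⟨fun _ => 2 * μ, fun _ => 0, fun x => ?_, fun x => hasDerivAt_const _ _,
      continuous_const, fun x => ?_⟩
    · simpa [gegen_zero] using hasDerivAt_gegen_succ μ 0 x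
    · simp [gegen_one]; ring
  · refine ⟨fun x => 2 * μ * gegen (μ + 1) (k + 1) x,
      fun x => 4 * μ * (μ + 1) * gegen (μ + 2) k x, hasDerivAt_gegen_succ μ (k + 1), fun x => ?_,
      continuous_const.mul (continuous_gegen _ _), fun x => ?_⟩
    · refine ((hasDerivAt_gegen_succ (μ + 1) k x).const_mul (2 * μ)).congr_deriv ?_
      rw [show μ + 1 + 1 = μ + 2 by ring]; ring
    · have h := gegen_ode μ k x
      push_cast
      linear_combination h

/-- The energy of a solution of `y'' + m cot α y' + κ y = 0` is maximal at `0` on `[0, π/2]`. -/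
lemma energy_le {m κ : ℝ} (hm : 0 < m) {y y₁ y₂ : ℝ → ℝ} (h₁ : ∀ α, HasDerivAt y (y₁ α) α)
    (h₂ : ∀ α, HasDerivAt y₁ (y₂ α) α)
    (hode : ∀ α, Real.sin α * y₂ α + m * Real.cos α * y₁ α + κ * Real.sin α * y α = 0)
    {α : ℝ} (hα : α ∈ Set.Icc 0 (π / 2)) : y₁ α ^ 2 + κ * y α ^ 2 ≤ κ * y 0 ^ 2 := by
  have h0 : y₁ 0 = 0 := by
    have := hode 0
    simpa [hm.ne'] using this
  have hd : ∀ t, HasDerivAt (fun t => y₁ t ^ 2 + κ * y t ^ 2)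
      (2 * y₁ t * y₂ t + κ * (2 * y t * y₁ t)) t := fun t => by
    have a := (h₂ t).fun_pow 2
    have b := ((h₁ t).fun_pow 2).const_mul κ
    refine (a.add b).congr_deriv ?_
    simp
  have hanti : AntitoneOn (fun t => y₁ t ^ 2 + κ * y t ^ 2) (Set.Icc 0 (π / 2)) := by
    refine antitoneOn_of_deriv_nonpos (convex_Icc _ _)
      (fun t _ => (hd t).continuousAt.continuousWithinAt)
      (fun t _ => (hd t).differentiableAt.differentiableWithinAt) fun t ht => ?_
    rw [interior_Icc] at ht
    rw [(hd t).deriv]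
    have hs : 0 < Real.sin t := Real.sin_pos_of_pos_of_lt_pi ht.1 (by linarith [ht.2, Real.pi_pos])
    have hc : 0 < Real.cos t := Real.cos_pos_of_mem_Ioo ⟨by linarith [ht.1, Real.pi_pos], ht.2⟩
    have e : Real.sin t * (2 * y₁ t * y₂ t + κ * (2 * y t * y₁ t))
        = -(2 * m * Real.cos t * y₁ t ^ 2) := by linear_combination 2 * y₁ t * hode t
    have : 0 ≤ 2 * m * Real.cos t * y₁ t ^ 2 := by positivity
    by_contra! hcon
    nlinarith [mul_pos hs hcon]
  have := hanti (Set.left_mem_Icc.2 (by positivity)) hα hα.1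
  simpa [h0] using this

lemma hasDerivAt_comp_cos {g g₁ g₂ : ℝ → ℝ} (h₁ : ∀ x, HasDerivAt g (g₁ x) x)
    (h₂ : ∀ x, HasDerivAt g₁ (g₂ x) x) (α : ℝ) :
    HasDerivAt (fun t => g (Real.cos t)) (-Real.sin α * g₁ (Real.cos α)) α ∧
    HasDerivAt (fun t => -Real.sin t * g₁ (Real.cos t))
      (-Real.cos α * g₁ (Real.cos α) + Real.sin α ^ 2 * g₂ (Real.cos α)) α := by
  have hc := Real.hasDerivAt_cos α
  refine ⟨((h₁ _).comp α hc).congr_deriv (by ring), ?_⟩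
  exact ((Real.hasDerivAt_sin α).neg.mul ((h₂ _).comp α hc)).congr_deriv (by simp; ring)

lemma abs_gegen_le {μ : ℝ} (hμ : 0 < μ) (k : ℕ) {x : ℝ} (hx : |x| ≤ 1) :
    |gegen μ k x| ≤ poch (2 * μ) k / (k.factorial : ℝ) := by
  wlog h0 : 0 ≤ x generalizing x
  · have := this (x := -x) (by rwa [abs_neg]) (by linarith)
    rwa [gegen_neg, abs_mul, abs_pow, abs_neg, abs_one, one_pow, one_mul] at this
  rw [← gegen_at_one hμ]
  rcases eq_or_ne k 0 with rfl | hk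
  · simp [gegen_zero]
  obtain ⟨g₁, g₂, h₁, h₂, -, hode⟩ := exists_gegen_derivs (μ := μ) hk
  have hx1 : x ≤ 1 := (le_abs_self x).trans hx
  have hκ : 0 < (k : ℝ) * (k + 2 * μ) := by
    have : 0 < (k : ℝ) := by positivity
    positivity
  have := energy_le (m := 2 * μ) (κ := (k : ℝ) * (k + 2 * μ)) (by positivity)
    (fun α => (hasDerivAt_comp_cos h₁ h₂ α).1) (fun α => (hasDerivAt_comp_cos h₁ h₂ α).2)
    (fun α => by
      have hs := Real.sin_sq_add_cos_sq α
      linear_combination Real.sin α * hode (Real.cos α)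
        + Real.sin α * g₂ (Real.cos α) * hs)
    (α := Real.arccos x) ⟨Real.arccos_nonneg x, Real.arccos_le_pi_div_two.2 h0⟩
  rw [Real.cos_zero, Real.cos_arccos (by linarith) hx1] at this
  have h3 : gegen μ k x ^ 2 ≤ gegen μ k 1 ^ 2 := by
    nlinarith [sq_nonneg (-Real.sin (Real.arccos x) * g₁ x)]
  have h1 : 0 ≤ gegen μ k 1 := by
    rw [gegen_at_one hμ]
    exact div_nonneg (poch_pos (by positivity) _).le (by positivity)
  exact abs_le_of_sq_le_sq h3 h1

/-- Differentiation under the integral sign for jointly continuous integrands. -/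
lemma hasDerivAt_intervalIntegral_of_continuous {f f' : ℝ → ℝ → ℝ} {a b : ℝ}
    (hf : ∀ α, Continuous (f α)) (hf' : Continuous fun p : ℝ × ℝ => f' p.1 p.2)
    (hd : ∀ α θ, HasDerivAt (fun α => f α θ) (f' α θ) α) (α : ℝ) :
    HasDerivAt (fun α => ∫ θ in a..b, f α θ) (∫ θ in a..b, f' α θ) α := by
  obtain ⟨C, hC⟩ := ((isCompact_closedBall α 1).prod
    (isCompact_uIcc (a := a) (b := b))).exists_bound_of_continuousOn hf'.continuousOn
  refine (intervalIntegral.hasDerivAt_integral_of_dominated_loc_of_deriv_le (F := f) (F' := f')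
    (bound := fun _ => C) (Metric.closedBall_mem_nhds α one_pos)
    (Filter.Eventually.of_forall fun x => (hf x).aestronglyMeasurable)
    ((hf α).intervalIntegrable _ _) ?_ ?_ intervalIntegrable_const ?_).2
  · exact (hf'.comp (by fun_prop : Continuous fun θ : ℝ => (α, θ))).aestronglyMeasurable
  · exact Filter.Eventually.of_forall fun θ hθ x hx =>
      hC (x, θ) ⟨hx, Set.uIoc_subset_uIcc hθ⟩
  · exact Filter.Eventually.of_forall fun θ _ x _ => hd x θ

/-- The spherical law of cosines expression appearing in the product formula. -/
noncomputable def sphZ (α β θ : ℝ) : ℝ :=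
  Real.cos α * Real.cos β + Real.sin α * Real.sin β * Real.cos θ

lemma product_formula_aux (N : ℕ) {κ : ℝ} (hκ : 0 < κ) {g g₁ g₂ : ℝ → ℝ}
    (h₁ : ∀ x, HasDerivAt g (g₁ x) x) (h₂ : ∀ x, HasDerivAt g₁ (g₂ x) x) (hg₂ : Continuous g₂)
    (hode : ∀ x, (1 - x ^ 2) * g₂ x - ((N : ℝ) + 2) * x * g₁ x + κ * g x = 0)
    (hg1 : g 1 ≠ 0) {α : ℝ} (hα : α ∈ Set.Icc 0 (π / 2)) (β : ℝ) :
    ∫ θ in (0 : ℝ)..π, g (sphZ α β θ) * Real.sin θ ^ N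
      = (∫ θ in (0 : ℝ)..π, Real.sin θ ^ N) * (g (Real.cos α) / g 1 * g (Real.cos β)) := by
  have cg : Continuous g := continuous_iff_continuousAt.2 fun x => (h₁ x).continuousAt
  have cg₁ : Continuous g₁ := continuous_iff_continuousAt.2 fun x => (h₂ x).continuousAt
  have cz : Continuous fun p : ℝ × ℝ => sphZ p.1 β p.2 := by unfold sphZ; fun_prop
  have cz' : ∀ α, Continuous fun θ : ℝ => sphZ α β θ := fun α => by unfold sphZ; fun_prop
  set w : ℝ → ℝ → ℝ := fun α θ =>
    -Real.sin α * Real.cos β + Real.cos α * Real.sin β * Real.cos θ with hw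
  have cw : Continuous fun p : ℝ × ℝ => w p.1 p.2 := by simp only [hw]; fun_prop
  have cw' : ∀ α, Continuous fun θ : ℝ => w α θ := fun α => by simp only [hw]; fun_prop
  have dz : ∀ α θ, HasDerivAt (fun α => sphZ α β θ) (w α θ) α := fun α θ =>
    (((Real.hasDerivAt_cos α).mul_const _).add
      (((Real.hasDerivAt_sin α).mul_const _).mul_const _))
  have dw : ∀ α θ, HasDerivAt (fun α => w α θ) (-sphZ α β θ) α := fun α θ =>
    ((((Real.hasDerivAt_sin α).neg.mul_const _).add
      (((Real.hasDerivAt_cos α).mul_const _).mul_const _))).congr_deriv (by unfold sphZ; ring)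
  set W := ∫ θ in (0 : ℝ)..π, Real.sin θ ^ N with hW
  set f₁ : ℝ → ℝ → ℝ := fun α θ => g₁ (sphZ α β θ) * w α θ * Real.sin θ ^ N with hf₁
  set f₂ : ℝ → ℝ → ℝ := fun α θ =>
    (g₂ (sphZ α β θ) * w α θ ^ 2 - g₁ (sphZ α β θ) * sphZ α β θ) * Real.sin θ ^ N with hf₂
  have d₁ : ∀ α, HasDerivAt (fun α => ∫ θ in (0 : ℝ)..π, g (sphZ α β θ) * Real.sin θ ^ N)
      (∫ θ in (0 : ℝ)..π, f₁ α θ) α := by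
    refine hasDerivAt_intervalIntegral_of_continuous (fun α => ?_) ?_ fun α θ => ?_
    · exact (cg.comp (cz' α)).mul (by fun_prop)
    · exact ((cg₁.comp cz).mul cw).mul (by fun_prop)
    · exact ((h₁ _).comp α (dz α θ)).mul_const _
  have d₂ : ∀ α, HasDerivAt (fun α => ∫ θ in (0 : ℝ)..π, f₁ α θ)
      (∫ θ in (0 : ℝ)..π, f₂ α θ) α := by
    refine hasDerivAt_intervalIntegral_of_continuous (fun α => ?_) ?_ fun α θ => ?_
    · exact ((cg₁.comp (cz' α)).mul (cw' α)).mul (by fun_prop)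
    · exact (((hg₂.comp cz).mul (cw.pow 2)).sub ((cg₁.comp cz).mul cz)).mul (by fun_prop)
    · exact ((((h₂ _).comp α (dz α θ)).mul (dw α θ)).mul_const _).congr_deriv (by
        simp only [hf₂, Function.comp]; ring)
  -- the integrated differential equation
  have hint : ∀ α, Real.sin α * (∫ θ in (0 : ℝ)..π, f₂ α θ)
      + ((N : ℝ) + 1) * Real.cos α * (∫ θ in (0 : ℝ)..π, f₁ α θ)
      + κ * Real.sin α * (∫ θ in (0 : ℝ)..π, g (sphZ α β θ) * Real.sin θ ^ N) = 0 := by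
    intro α
    have c0 : Continuous fun θ => g (sphZ α β θ) * Real.sin θ ^ N :=
      (cg.comp (cz' α)).mul (by fun_prop)
    have c1 : Continuous fun θ => f₁ α θ :=
      ((cg₁.comp (cz' α)).mul (cw' α)).mul (by fun_prop)
    have c2 : Continuous fun θ => f₂ α θ :=
      (((hg₂.comp (cz' α)).mul ((cw' α).pow 2)).sub ((cg₁.comp (cz' α)).mul (cz' α))).mul
        (by fun_prop)
    have c3 : Continuous fun θ =>
        Real.sin α * f₂ α θ + ((N : ℝ) + 1) * Real.cos α * f₁ α θ :=
      (c2.const_mul _).add (c1.const_mul _)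
    rw [← intervalIntegral.integral_const_mul, ← intervalIntegral.integral_const_mul,
      ← intervalIntegral.integral_const_mul,
      ← intervalIntegral.integral_add ((c2.const_mul _).intervalIntegrable _ _)
        ((c1.const_mul _).intervalIntegrable _ _),
      ← intervalIntegral.integral_add
        (c3.intervalIntegrable _ _)
        ((c0.const_mul _).intervalIntegrable _ _)]
    have hprim : ∀ θ, HasDerivAt
        (fun θ => Real.sin β * (Real.sin θ ^ (N + 1) * g₁ (sphZ α β θ)))
        (Real.sin α * f₂ α θ + ((N : ℝ) + 1) * Real.cos α * f₁ α θ
          + κ * Real.sin α * (g (sphZ α β θ) * Real.sin θ ^ N)) θ := by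
      intro θ
      have hz : HasDerivAt (fun θ => sphZ α β θ) (Real.sin α * Real.sin β * -Real.sin θ) θ :=
        ((Real.hasDerivAt_cos θ).const_mul _).const_add _
      refine ((((Real.hasDerivAt_sin θ).fun_pow (N + 1)).mul
        ((h₂ _).comp θ hz)).const_mul _).congr_deriv ?_
      have ho := hode (sphZ α β θ)
      have e1 := Real.sin_sq_add_cos_sq α
      have e2 := Real.sin_sq_add_cos_sq β
      have e3 := Real.sin_sq_add_cos_sq θ
      have ew : w α θ ^ 2 = 1 - sphZ α β θ ^ 2 - Real.sin β ^ 2 * Real.sin θ ^ 2 := by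
        simp only [hw, sphZ]
        linear_combination (Real.cos β ^ 2 + Real.sin β ^ 2 * Real.cos θ ^ 2) * e1 + e2
          + Real.sin β ^ 2 * e3
      have ew' : Real.cos α * w α θ
          = -Real.sin α * sphZ α β θ + Real.sin β * Real.cos θ := by
        simp only [hw, sphZ]
        linear_combination Real.sin β * Real.cos θ * e1
      simp only [hf₁, hf₂, Function.comp, Nat.cast_add, Nat.cast_one, Nat.add_sub_cancel, ew]
      generalize sphZ α β θ = z at ho ew' ⊢
      linear_combination (-Real.sin α * Real.sin θ ^ N) * ho
        - ((N : ℝ) + 1) * g₁ z * Real.sin θ ^ N * ew'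
    rw [intervalIntegral.integral_eq_sub_of_hasDerivAt (fun θ _ => hprim θ)
      ((c3.add (c0.const_mul _)).intervalIntegrable _ _)]
    simp
  set c := W * g (Real.cos β) / g 1 with hc
  have hy0 : (∫ θ in (0 : ℝ)..π, g (sphZ 0 β θ) * Real.sin θ ^ N) - c * g (Real.cos 0) = 0 := by
    simp only [sphZ, Real.cos_zero, Real.sin_zero, one_mul, zero_mul, add_zero, 
      intervalIntegral.integral_const_mul, hc]
    field_simp
    rw [hW]; ring
  have := energy_le (m := (N : ℝ) + 1) (κ := κ) (by positivity)
    (fun α => (d₁ α).sub ((hasDerivAt_comp_cos h₁ h₂ α).1.const_mul c))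
    (fun α => (d₂ α).sub ((hasDerivAt_comp_cos h₁ h₂ α).2.const_mul c))
    (fun α => by
      have hs := Real.sin_sq_add_cos_sq α
      simp only [Pi.sub_apply]
      linear_combination hint α - c * Real.sin α * hode (Real.cos α)
        - c * Real.sin α * g₂ (Real.cos α) * hs) hα
  simp only [Pi.sub_apply] at this
  rw [hy0] at this
  have hzero : (∫ θ in (0 : ℝ)..π, g (sphZ α β θ) * Real.sin θ ^ N) - c * g (Real.cos α) = 0 := by
    have h3 : κ * ((∫ θ in (0 : ℝ)..π, g (sphZ α β θ) * Real.sin θ ^ N)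
        - c * g (Real.cos α)) ^ 2 ≤ 0 := by
      nlinarith [sq_nonneg ((∫ θ in (0 : ℝ)..π, f₁ α θ) - c * (-Real.sin α * g₁ (Real.cos α)))]
    have h4 := nonpos_of_mul_nonpos_right h3 hκ
    exact pow_eq_zero_iff two_ne_zero |>.1 (le_antisymm h4 (sq_nonneg _))
  rw [sub_eq_zero.1 hzero, hc]
  ring

/-! ### The generating function -/

lemma summable_poch_div_factorial {a r : ℝ} (ha : 0 < a) (hr : 0 ≤ r) (hr1 : r < 1) :
    Summable fun k : ℕ => poch a k / (k.factorial : ℝ) * r ^ k := by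
  rcases hr.eq_or_lt with rfl | hr0
  · refine summable_of_ne_finset_zero (s := {0}) fun k hk => ?_
    rw [Finset.mem_singleton] at hk
    simp [hk]
  refine summable_of_ratio_test_tendsto_lt_one (l := r) hr1
    (Filter.Eventually.of_forall fun k => ?_) ?_
  · have := poch_pos ha k
    positivity
  · have e : (fun k : ℕ => ‖poch a (k + 1) / ((k + 1).factorial : ℝ) * r ^ (k + 1)‖
        / ‖poch a k / (k.factorial : ℝ) * r ^ k‖) = fun k : ℕ => (1 + (a - 1) / ((k : ℝ) + 1)) * r := by
      ext k
      have h0 := poch_pos ha k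
      have h1 := poch_pos ha (k + 1)
      rw [Real.norm_of_nonneg (by positivity), Real.norm_of_nonneg (by positivity), poch_succ,
        Nat.factorial_succ]
      push_cast
      field_simp
      ring
    rw [e]
    have h : Filter.Tendsto (fun k : ℕ => (a - 1) / ((k : ℝ) + 1)) Filter.atTop (nhds 0) :=
      Filter.Tendsto.const_div_atTop
        (Filter.tendsto_atTop_add_const_right _ _ tendsto_natCast_atTop_atTop) _
    simpa using (h.const_add 1).mul_const r

lemma abs_gegen_mul_pow_le {μ : ℝ} (hμ : 0 < μ) (k : ℕ) {x ρ r : ℝ} (hx : |x| ≤ 1) (hρ : |ρ| ≤ r) :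
    ‖gegen μ k x * ρ ^ k‖ ≤ poch (2 * μ) k / (k.factorial : ℝ) * r ^ k := by
  rw [Real.norm_eq_abs, abs_mul, abs_pow]
  have := abs_gegen_le hμ k hx
  have h0 : 0 ≤ r := (abs_nonneg _).trans hρ
  exact mul_le_mul this (pow_le_pow_left₀ (abs_nonneg _) hρ k) (by positivity)
    ((abs_nonneg _).trans this)

lemma summable_gegen_mul_pow {μ : ℝ} (hμ : 0 < μ) {x ρ : ℝ} (hx : |x| ≤ 1) (hρ : |ρ| < 1) :
    Summable fun k : ℕ => gegen μ k x * ρ ^ k :=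
  (summable_poch_div_factorial (by positivity) (abs_nonneg ρ) hρ).of_norm_bounded
    fun k => abs_gegen_mul_pow_le hμ k hx le_rfl

lemma abs_succ_mul_gegen_le {μ : ℝ} (hμ : 0 < μ) (k : ℕ) {x ρ r : ℝ} (hx : |x| ≤ 1)
    (hρ : |ρ| ≤ r) : ‖gegen μ (k + 1) x * (((k : ℝ) + 1) * ρ ^ k)‖
      ≤ 2 * μ * (poch (2 * μ + 1) k / (k.factorial : ℝ) * r ^ k) := by
  rw [Real.norm_eq_abs, abs_mul, abs_mul, abs_pow, abs_of_pos (by positivity : (0 : ℝ) < k + 1)]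
  have h := abs_gegen_le hμ (k + 1) hx
  rw [poch_succ_left, Nat.factorial_succ] at h
  have hp := poch_pos (show 0 < 2 * μ + 1 by positivity) k
  have h0 : 0 ≤ r := (abs_nonneg _).trans hρ
  calc |gegen μ (k + 1) x| * (((k : ℝ) + 1) * |ρ| ^ k)
      ≤ 2 * μ * poch (2 * μ + 1) k / (((k + 1) * k.factorial : ℕ) : ℝ)
        * (((k : ℝ) + 1) * r ^ k) := by gcongr
    _ = _ := by
        have : (k.factorial : ℝ) ≠ 0 := by positivity
        push_cast
        field_simp

lemma summable_succ_mul_gegen {μ : ℝ} (hμ : 0 < μ) {x ρ : ℝ} (hx : |x| ≤ 1) (hρ : |ρ| < 1) :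
    Summable fun k : ℕ => gegen μ (k + 1) x * (((k : ℝ) + 1) * ρ ^ k) :=
  ((summable_poch_div_factorial (by positivity) (abs_nonneg ρ) hρ).mul_left (2 * μ)).of_norm_bounded
    fun k => abs_succ_mul_gegen_le hμ k hx le_rfl

lemma hasDerivAt_tsum_gegen {μ : ℝ} (hμ : 0 < μ) {x ρ : ℝ} (hx : |x| ≤ 1) (hρ : |ρ| < 1) :
    HasDerivAt (fun ρ => ∑' k : ℕ, gegen μ k x * ρ ^ k)
      (∑' k : ℕ, gegen μ (k + 1) x * (((k : ℝ) + 1) * ρ ^ k)) ρ := by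
  obtain ⟨r, h1, h2⟩ := exists_between hρ
  have hr0 : 0 < r := (abs_nonneg ρ).trans_lt h1
  have hr : |r| < 1 := by rwa [abs_of_pos hr0]
  set u : ℕ → ℝ := fun k =>
    match k with
    | 0 => 0
    | k + 1 => 2 * μ * (poch (2 * μ + 1) k / (k.factorial : ℝ) * r ^ k) with hu
  have hus : Summable u := by
    rw [← summable_nat_add_iff 1]
    exact (summable_poch_div_factorial (by positivity) hr0.le h2).mul_left (2 * μ)
  have hd := hasDerivAt_tsum_of_isPreconnected (t := Metric.ball (0 : ℝ) r) (u := u)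
    (g := fun (k : ℕ) (ρ : ℝ) => gegen μ k x * ρ ^ k)
    (g' := fun (k : ℕ) (ρ : ℝ) => gegen μ k x * ((k : ℝ) * ρ ^ (k - 1))) (y₀ := 0) (y := ρ)
    hus Metric.isOpen_ball (convex_ball _ _).isPreconnected
    (fun k y _ => (hasDerivAt_pow k y).const_mul _)
    (fun k y hy => by
      rcases k with _ | k
      · simp [hu]
      · rw [mem_ball_zero_iff, Real.norm_eq_abs] at hy
        have := abs_succ_mul_gegen_le hμ k hx hy.le
        simpa [hu] using this)
    (Metric.mem_ball_self hr0) (summable_gegen_mul_pow hμ hx (by simp))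
    (by rwa [mem_ball_zero_iff, Real.norm_eq_abs])
  refine hd.congr_deriv ?_
  have hs : Summable fun k : ℕ => gegen μ k x * ((k : ℝ) * ρ ^ (k - 1)) := by
    rw [← summable_nat_add_iff 1]
    simpa using summable_succ_mul_gegen hμ hx hρ
  rw [hs.tsum_eq_zero_add]
  simp

lemma gegen_base_pos {x ρ : ℝ} (hx : |x| ≤ 1) (hρ : |ρ| < 1) : 0 < 1 + ρ ^ 2 - 2 * ρ * x := by
  have h1 : ρ * x ≤ |ρ| := by
    calc ρ * x ≤ |ρ * x| := le_abs_self _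
      _ = |ρ| * |x| := abs_mul _ _
      _ ≤ |ρ| * 1 := by gcongr
      _ = |ρ| := mul_one _
  have h2 : 0 < (1 - |ρ|) ^ 2 := by
    have : 0 < 1 - |ρ| := by linarith
    positivity
  nlinarith [sq_abs ρ]

lemma tsum_gegen_ode {μ : ℝ} (hμ : 0 < μ) {x ρ : ℝ} (hx : |x| ≤ 1) (hρ : |ρ| < 1) :
    (1 + ρ ^ 2 - 2 * ρ * x) * ∑' k : ℕ, gegen μ (k + 1) x * (((k : ℝ) + 1) * ρ ^ k)
      = 2 * μ * (x - ρ) * ∑' k : ℕ, gegen μ k x * ρ ^ k := by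
  have hs := summable_gegen_mul_pow hμ hx hρ
  have hs' := summable_succ_mul_gegen hμ hx hρ
  have t0 := hs.hasSum
  have t1 := ((hasSum_nat_add_iff' 1).2 t0)
  have d0 := hs'.hasSum
  have d1 := ((hasSum_nat_add_iff' 1).2 d0)
  set g := ∑' k : ℕ, gegen μ k x * ρ ^ k
  set d := ∑' k : ℕ, gegen μ (k + 1) x * (((k : ℝ) + 1) * ρ ^ k)
  have e : HasSum (fun k : ℕ => (gegen μ (k + 1) x * ρ ^ (k + 1)) * (2 * μ * x)
      - (gegen μ k x * ρ ^ k) * (2 * μ * ρ)) (d - 2 * μ * x + ρ ^ 2 * d - 2 * ρ * x * d) := by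
    have := (d1.sub (d0.mul_left (2 * ρ * x))).add ((?_ : HasSum
      (fun k : ℕ => (k : ℝ) * gegen μ k x * ρ ^ (k + 1)) (ρ ^ 2 * d)))
    · rw [show d - 2 * μ * x + ρ ^ 2 * d - 2 * ρ * x * d
        = d - ∑ i ∈ Finset.range 1, gegen μ (i + 1) x * (((i : ℝ) + 1) * ρ ^ i)
          - 2 * ρ * x * d + ρ ^ 2 * d by simp [gegen_one]; ring]
      refine this.congr_fun fun k => ?_
      have hr := gegen_rec μ k x
      push_cast
      linear_combination (-ρ ^ (k + 1)) * hr
    · rw [← hasSum_nat_add_iff' 1]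
      simp only [Finset.range_one, Finset.sum_singleton, Nat.cast_zero, zero_mul, sub_zero]
      refine (d0.mul_left (ρ ^ 2)).congr_fun fun k => ?_
      push_cast
      ring
  have := e.unique ((t1.mul_right (2 * μ * x)).sub (t0.mul_right (2 * μ * ρ)))
  simp only [Finset.range_one, Finset.sum_singleton, gegen_zero, pow_zero, mul_one] at this
  linear_combination this

/-- The generating function of the Gegenbauer polynomials. -/
lemma hasSum_gegen {μ : ℝ} (hμ : 0 < μ) {x ρ : ℝ} (hx : |x| ≤ 1) (hρ0 : 0 ≤ ρ) (hρ : ρ < 1) :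
    HasSum (fun k : ℕ => gegen μ k x * ρ ^ k) ((1 + ρ ^ 2 - 2 * ρ * x) ^ (-μ)) := by
  have habs : ∀ {t}, 0 ≤ t → t ≤ ρ → |t| < 1 := fun h0 h1 => by
    rw [abs_of_nonneg h0]; linarith
  have hd : ∀ t, 0 ≤ t → t ≤ ρ →
      HasDerivAt (fun t => (∑' k : ℕ, gegen μ k x * t ^ k) * (1 + t ^ 2 - 2 * t * x) ^ μ) 0 t := by
    intro t h0 h1
    have hpos := gegen_base_pos hx (habs h0 h1)
    have hb : HasDerivAt (fun t : ℝ => 1 + t ^ 2 - 2 * t * x) (2 * t - 2 * x) t := by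
      have := (((hasDerivAt_id t).fun_pow 2).const_add 1).fun_sub
        (((hasDerivAt_id t).const_mul 2).mul_const x)
      simpa using this
    refine ((hasDerivAt_tsum_gegen hμ hx (habs h0 h1)).mul
      (hb.rpow_const (p := μ) (Or.inl hpos.ne'))).congr_deriv ?_
    have h := tsum_gegen_ode hμ hx (habs h0 h1)
    rw [Real.rpow_sub_one hpos.ne', eq_div_of_mul_eq hpos.ne' ((mul_comm _ _).trans h)]
    generalize (1 + t ^ 2 - 2 * t * x) = B at hpos ⊢
    field_simp
    ring
  have hc := constant_of_has_deriv_right_zero (a := 0) (b := ρ)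
    (fun t ht => (hd t ht.1 ht.2).continuousAt.continuousWithinAt)
    (fun t ht => (hd t ht.1 ht.2.le).hasDerivWithinAt) ρ ⟨hρ0, le_rfl⟩
  have hpos := gegen_base_pos hx (habs hρ0 le_rfl)
  have h00 : (∑' k : ℕ, gegen μ k x * (0 : ℝ) ^ k) = 1 := by
    rw [tsum_eq_single 0 (fun k hk => by simp [hk])]
    simp [gegen_zero]
  simp only [h00] at hc
  norm_num at hc
  have := (summable_gegen_mul_pow hμ hx (habs hρ0 le_rfl)).hasSum
  rwa [eq_div_of_mul_eq (Real.rpow_pos_of_pos hpos μ).ne' hc, one_div,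
    ← Real.rpow_neg hpos.le] at this

/-! ### The bilinear Gegenbauer kernel -/

/-- Gegenbauer polynomials of order `(N + 1) / 2`, normalized to be `1` at `1`. -/
noncomputable def gegenR (N k : ℕ) (x : ℝ) : ℝ :=
  (k.factorial : ℝ) / poch ((N : ℝ) + 1) k * gegen (((N : ℝ) + 1) / 2) k x

/-- The argument in the product formula, as a function of the two cosines. -/
noncomputable def kerZ (s t θ : ℝ) : ℝ :=
  s * t + √(1 - s ^ 2) * √(1 - t ^ 2) * Real.cos θ

lemma continuous_kerZ (s t : ℝ) : Continuous (kerZ s t) := by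
  unfold kerZ; fun_prop

lemma abs_kerZ_le {s t : ℝ} (hs : |s| ≤ 1) (ht : |t| ≤ 1) (θ : ℝ) : |kerZ s t θ| ≤ 1 := by
  have hs2 : 0 ≤ 1 - s ^ 2 := by nlinarith [sq_abs s, abs_nonneg s]
  have ht2 : 0 ≤ 1 - t ^ 2 := by nlinarith [sq_abs t, abs_nonneg t]
  have h1 := Real.sq_sqrt hs2
  have h2 := Real.sq_sqrt ht2
  have h0 := mul_nonneg (Real.sqrt_nonneg (1 - s ^ 2)) (Real.sqrt_nonneg (1 - t ^ 2))
  set a := √(1 - s ^ 2)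
  set b := √(1 - t ^ 2)
  have hc := Real.abs_cos_le_one θ
  have hc1 := abs_le.1 hc
  unfold kerZ
  rw [abs_le]
  constructor
  · nlinarith [sq_nonneg (s + t), sq_nonneg (a - b), mul_nonneg h0 (by linarith : 0 ≤ 1 + Real.cos θ)]
  · nlinarith [sq_nonneg (s - t), sq_nonneg (a - b), mul_nonneg h0 (by linarith : 0 ≤ 1 - Real.cos θ)]

lemma gegenR_neg_mul_gegen_neg (N k : ℕ) (μ s t : ℝ) :
    gegenR N k (-s) * gegen μ k (-t) = gegenR N k s * gegen μ k t := by
  simp only [gegenR, gegen_neg]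
  have : ((-1 : ℝ) ^ k) * (-1) ^ k = 1 := by rw [← mul_pow]; simp
  linear_combination (k.factorial / poch ((N : ℝ) + 1) k * gegen (((N : ℝ) + 1) / 2) k s
    * gegen μ k t) * this

lemma abs_gegenR_le (N k : ℕ) {x : ℝ} (hx : |x| ≤ 1) : |gegenR N k x| ≤ 1 := by
  have h := abs_gegen_le (μ := ((N : ℝ) + 1) / 2) (by positivity) k hx
  rw [show 2 * (((N : ℝ) + 1) / 2) = N + 1 by ring] at h
  have hp := poch_pos (show 0 < (N : ℝ) + 1 by positivity) k
  rw [gegenR, abs_mul, abs_of_pos (by positivity)]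
  calc _ ≤ (k.factorial : ℝ) / poch ((N : ℝ) + 1) k
        * (poch ((N : ℝ) + 1) k / (k.factorial : ℝ)) := by gcongr
    _ = 1 := by
      have : (k.factorial : ℝ) ≠ 0 := by positivity
      field_simp

/-- Gegenbauer's product formula. -/
lemma integral_gegen_kerZ (N k : ℕ) {s t : ℝ} (hs : |s| ≤ 1) (ht : |t| ≤ 1) :
    ∫ θ in (0 : ℝ)..π, gegen (((N : ℝ) + 1) / 2) k (kerZ s t θ) * Real.sin θ ^ N
      = (∫ θ in (0 : ℝ)..π, Real.sin θ ^ N)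
        * (gegenR N k s * gegen (((N : ℝ) + 1) / 2) k t) := by
  wlog h0 : 0 ≤ s generalizing s t
  · have := this (s := -s) (t := -t) (by rwa [abs_neg]) (by rwa [abs_neg]) (by linarith)
    rw [gegenR_neg_mul_gegen_neg] at this
    simpa [kerZ] using this
  rcases eq_or_ne k 0 with rfl | hk
  · simp [gegenR, gegen_zero, poch_zero]
  have hμ : 0 < ((N : ℝ) + 1) / 2 := by positivity
  have hκ : 0 < (k : ℝ) * (k + 2 * (((N : ℝ) + 1) / 2)) := by
    have : 0 < (k : ℝ) := by positivity
    positivity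
  obtain ⟨g₁, g₂, h₁, h₂, hg, hode⟩ := exists_gegen_derivs (μ := ((N : ℝ) + 1) / 2) hk
  have h1 := gegen_at_one hμ k
  rw [show 2 * (((N : ℝ) + 1) / 2) = N + 1 by ring] at h1
  have hp := poch_pos (show 0 < (N : ℝ) + 1 by positivity) k
  have hne : gegen (((N : ℝ) + 1) / 2) k 1 ≠ 0 := by rw [h1]; positivity
  have key := product_formula_aux N hκ h₁ h₂ hg
    (fun x => by linear_combination hode x) hne (α := Real.arccos s)
    ⟨Real.arccos_nonneg s, Real.arccos_le_pi_div_two.2 h0⟩ (Real.arccos t)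
  have hs' := abs_le.1 hs
  have ht' := abs_le.1 ht
  simp only [sphZ, Real.sin_arccos, Real.cos_arccos hs'.1 hs'.2,
    Real.cos_arccos ht'.1 ht'.2] at key
  simp only [kerZ]
  rw [key, h1, gegenR]
  have : (k.factorial : ℝ) ≠ 0 := by positivity
  field_simp

lemma continuous_kernel (μ : ℝ) {s t ρ : ℝ} (hs : |s| ≤ 1) (ht : |t| ≤ 1) (hρ : |ρ| < 1) :
    Continuous fun θ => (1 + ρ ^ 2 - 2 * ρ * kerZ s t θ) ^ μ :=
  (continuous_const.sub (continuous_const.mul (continuous_kerZ s t))).rpow_const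
    fun θ => Or.inl (gegen_base_pos (abs_kerZ_le hs ht θ) hρ).ne'

/-- The bilinear generating function of the Gegenbauer polynomials. -/
lemma hasSum_gegenR_mul_gegen (N : ℕ) {s t ρ : ℝ} (hs : |s| ≤ 1) (ht : |t| ≤ 1) (hρ0 : 0 ≤ ρ)
    (hρ : ρ < 1) :
    HasSum (fun k : ℕ => gegenR N k s * gegen (((N : ℝ) + 1) / 2) k t * ρ ^ k)
      ((∫ θ in (0 : ℝ)..π, (1 + ρ ^ 2 - 2 * ρ * kerZ s t θ) ^ (-(((N : ℝ) + 1) / 2))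
        * Real.sin θ ^ N) / ∫ θ in (0 : ℝ)..π, Real.sin θ ^ N) := by
  have hμ : 0 < ((N : ℝ) + 1) / 2 := by positivity
  have hW : 0 < ∫ θ in (0 : ℝ)..π, Real.sin θ ^ N := integral_sin_pow_pos N
  have hρa : |ρ| < 1 := by rwa [abs_of_nonneg hρ0]
  have := intervalIntegral.hasSum_integral_of_dominated_convergence (a := 0) (b := π)
    (μ := MeasureTheory.volume)
    (F := fun (k : ℕ) θ => gegen (((N : ℝ) + 1) / 2) k (kerZ s t θ) * ρ ^ k * Real.sin θ ^ N)
    (f := fun θ => (1 + ρ ^ 2 - 2 * ρ * kerZ s t θ) ^ (-(((N : ℝ) + 1) / 2)) * Real.sin θ ^ N)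
    (bound := fun k _ => poch (2 * (((N : ℝ) + 1) / 2)) k / (k.factorial : ℝ) * ρ ^ k)
    (fun k => (((((continuous_gegen _ k).comp (continuous_kerZ s t)).mul_const _).mul
      (by fun_prop : Continuous fun θ => Real.sin θ ^ N))).aestronglyMeasurable)
    (fun k => Filter.Eventually.of_forall fun θ _ => by
      rw [norm_mul]
      have h1 := abs_gegen_mul_pow_le hμ k (abs_kerZ_le hs ht θ) (abs_of_nonneg hρ0).le
      have h2 : ‖Real.sin θ ^ N‖ ≤ 1 := by
        rw [norm_pow]
        exact pow_le_one₀ (norm_nonneg _) (Real.abs_sin_le_one θ)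
      calc _ ≤ poch (2 * (((N : ℝ) + 1) / 2)) k / (k.factorial : ℝ) * ρ ^ k * 1 :=
            mul_le_mul h1 h2 (norm_nonneg _) ((norm_nonneg _).trans h1)
        _ = _ := mul_one _)
    (Filter.Eventually.of_forall fun θ _ =>
      summable_poch_div_factorial (by positivity) hρ0 hρ)
    intervalIntegrable_const
    (Filter.Eventually.of_forall fun θ _ =>
      (hasSum_gegen hμ (abs_kerZ_le hs ht θ) hρ0 hρ).mul_right _)
  refine (this.div_const (∫ θ in (0 : ℝ)..π, Real.sin θ ^ N)).congr_fun ?_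
  intro k
  rw [eq_div_iff hW.ne', show (fun θ => gegen (((N : ℝ) + 1) / 2) k (kerZ s t θ) * ρ ^ k
      * Real.sin θ ^ N) = fun θ => ρ ^ k * (gegen (((N : ℝ) + 1) / 2) k (kerZ s t θ)
      * Real.sin θ ^ N) from funext fun θ => by ring, intervalIntegral.integral_const_mul,
    integral_gegen_kerZ N k hs ht]
  ring

/-! ### Nonnegativity of a quadratic combination of kernels -/

/-- The value of the bilinear generating function of order `(N + 1) / 2`. -/
noncomputable def gegenKernel (N : ℕ) (ρ s t : ℝ) : ℝ :=
  (∫ θ in (0 : ℝ)..π, (1 + ρ ^ 2 - 2 * ρ * kerZ s t θ) ^ (-(((N : ℝ) + 1) / 2))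
    * Real.sin θ ^ N) / ∫ θ in (0 : ℝ)..π, Real.sin θ ^ N

lemma integral_sin_pow_add_two (N : ℕ) :
    ∫ θ in (0 : ℝ)..π, Real.sin θ ^ (N + 2)
      = ((N : ℝ) + 1) / (N + 2) * ∫ θ in (0 : ℝ)..π, Real.sin θ ^ N := by
  rw [integral_sin_pow]; simp

lemma gegenKernel_quadratic_nonneg (M : ℕ) {ρ s t : ℝ} (hs : |s| ≤ 1) (ht : |t| ≤ 1)
    (hρ : |ρ| < 1) (d q : ℝ) :
    0 ≤ d ^ 2 * gegenKernel M ρ s t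
      - 2 * d * q * (((M : ℝ) + 1) / (M + 2)) * gegenKernel (M + 2) ρ s t
      + q ^ 2 * (((M : ℝ) + 1) * (M + 3) / ((M + 2) * (M + 4))) * gegenKernel (M + 4) ρ s t := by
  have hX : ∀ θ, 0 < 1 + ρ ^ 2 - 2 * ρ * kerZ s t θ := fun θ =>
    gegen_base_pos (abs_kerZ_le hs ht θ) hρ
  set X : ℝ → ℝ := fun θ => 1 + ρ ^ 2 - 2 * ρ * kerZ s t θ with hXdef
  have hW := integral_sin_pow_pos M
  have hW2 := integral_sin_pow_add_two M
  have hW4 := integral_sin_pow_add_two (M + 2)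
  rw [hW2] at hW4
  push_cast at hW4
  have hi : ∀ N : ℕ, IntervalIntegrable
      (fun θ => X θ ^ (-(((N : ℝ) + 1) / 2)) * Real.sin θ ^ N) MeasureTheory.volume 0 π :=
    fun N => ((continuous_kernel _ hs ht hρ).mul
      (by fun_prop : Continuous fun θ => Real.sin θ ^ N)).intervalIntegrable _ _
  have hnonneg : 0 ≤ ∫ θ in (0 : ℝ)..π,
      X θ ^ (-(((M : ℝ) + 1) / 2)) * Real.sin θ ^ M * (d - q * Real.sin θ ^ 2 / X θ) ^ 2 := by
    refine intervalIntegral.integral_nonneg Real.pi_pos.le fun θ hθ => ?_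
    have := Real.sin_nonneg_of_mem_Icc hθ
    have := hX θ
    positivity
  have hexp : ∀ θ, X θ ^ (-(((M : ℝ) + 1) / 2)) * Real.sin θ ^ M
        * (d - q * Real.sin θ ^ 2 / X θ) ^ 2
      = d ^ 2 * (X θ ^ (-(((M : ℝ) + 1) / 2)) * Real.sin θ ^ M)
        - 2 * d * q * (X θ ^ (-((((M + 2 : ℕ) : ℝ) + 1) / 2)) * Real.sin θ ^ (M + 2))
        + q ^ 2 * (X θ ^ (-((((M + 4 : ℕ) : ℝ) + 1) / 2)) * Real.sin θ ^ (M + 4)) := by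
    intro θ
    have h : X θ ≠ 0 := (hX θ).ne'
    rw [show (-((((M + 2 : ℕ) : ℝ) + 1) / 2)) = -(((M : ℝ) + 1) / 2) - 1 by push_cast; ring,
      show (-((((M + 4 : ℕ) : ℝ) + 1) / 2)) = -(((M : ℝ) + 1) / 2) - 1 - 1 by push_cast; ring,
      Real.rpow_sub_one h, Real.rpow_sub_one h, Real.rpow_sub_one h]
    field_simp
    ring
  simp only [hexp] at hnonneg
  rw [intervalIntegral.integral_add (((hi M).const_mul _).sub ((hi (M + 2)).const_mul _))
      ((hi (M + 4)).const_mul _),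
    intervalIntegral.integral_sub ((hi M).const_mul _) ((hi (M + 2)).const_mul _),
    intervalIntegral.integral_const_mul, intervalIntegral.integral_const_mul,
    intervalIntegral.integral_const_mul] at hnonneg
  unfold gegenKernel
  rw [hW4, hW2]
  refine (div_nonneg hnonneg hW.le).trans_eq ?_
  simp only [hXdef]
  field_simp
  ring

/-! ### Truncation errors -/

/-- A uniform bound for the truncation error of the series for `gegenKernel`. -/
noncomputable def gegenTail (N : ℕ) (ρ : ℝ) (m : ℕ) : ℝ :=
  ∑' k : ℕ, poch ((N : ℝ) + 1) (k + m) / ((k + m).factorial : ℝ) * ρ ^ (k + m)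

lemma tendsto_gegenTail (N : ℕ) (ρ : ℝ) :
    Filter.Tendsto (gegenTail N ρ) Filter.atTop (nhds 0) :=
  tendsto_sum_nat_add fun k : ℕ => poch ((N : ℝ) + 1) k / (k.factorial : ℝ) * ρ ^ k

lemma abs_gegenR_mul_gegen_le (N k : ℕ) {s t ρ : ℝ} (hs : |s| ≤ 1) (ht : |t| ≤ 1) (hρ : 0 ≤ ρ) :
    ‖gegenR N k s * gegen (((N : ℝ) + 1) / 2) k t * ρ ^ k‖
      ≤ poch ((N : ℝ) + 1) k / (k.factorial : ℝ) * ρ ^ k := by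
  have h := abs_gegen_mul_pow_le (μ := ((N : ℝ) + 1) / 2) (by positivity) k ht
    (abs_of_nonneg hρ).le
  rw [show 2 * (((N : ℝ) + 1) / 2) = N + 1 by ring] at h
  rw [mul_assoc, norm_mul]
  exact (mul_le_of_le_one_left (norm_nonneg _) (abs_gegenR_le N k hs)).trans h

lemma abs_gegenKernel_sub_sum_le (N m : ℕ) {s t ρ : ℝ} (hs : |s| ≤ 1) (ht : |t| ≤ 1)
    (hρ0 : 0 ≤ ρ) (hρ : ρ < 1) :
    |gegenKernel N ρ s t
      - ∑ k ∈ Finset.range m, gegenR N k s * gegen (((N : ℝ) + 1) / 2) k t * ρ ^ k|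
      ≤ gegenTail N ρ m := by
  have h : HasSum _ (gegenKernel N ρ s t) := hasSum_gegenR_mul_gegen N hs ht hρ0 hρ
  have h' := (hasSum_nat_add_iff' m).2 h
  rw [← h'.tsum_eq]
  exact tsum_of_norm_bounded ((summable_nat_add_iff m).2
    (summable_poch_div_factorial (by positivity) hρ0 hρ)).hasSum
    fun k => abs_gegenR_mul_gegen_le N (k + m) hs ht hρ0

/-! ### Second derivatives on a set -/

/-- `f` is twice differentiable at every point of `s`, with second derivative `f''`. -/
def HasSecondDerivOn (f f'' : ℝ → ℝ) (s : Set ℝ) : Prop :=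
  ∃ f' : ℝ → ℝ, (∀ t ∈ s, HasDerivAt f (f' t) t) ∧ ∀ t ∈ s, HasDerivAt f' (f'' t) t

namespace HasSecondDerivOn

lemma add {f g f'' g'' : ℝ → ℝ} {s : Set ℝ} (hf : HasSecondDerivOn f f'' s)
    (hg : HasSecondDerivOn g g'' s) :
    HasSecondDerivOn (fun t => f t + g t) (fun t => f'' t + g'' t) s := by
  obtain ⟨f', h1, h2⟩ := hf
  obtain ⟨g', h3, h4⟩ := hg
  exact ⟨fun t => f' t + g' t, fun t ht => (h1 t ht).fun_add (h3 t ht),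
    fun t ht => (h2 t ht).fun_add (h4 t ht)⟩

lemma sum {f f'' : ℕ → ℝ → ℝ} {s : Set ℝ} (h : ∀ k, HasSecondDerivOn (f k) (f'' k) s)
    (A : Finset ℕ) :
    HasSecondDerivOn (fun t => ∑ k ∈ A, f k t) (fun t => ∑ k ∈ A, f'' k t) s := by
  choose f' h1 h2 using h
  exact ⟨fun t => ∑ k ∈ A, f' k t, fun t ht => HasDerivAt.fun_sum fun k _ => h1 k t ht,
    fun t ht => HasDerivAt.fun_sum fun k _ => h2 k t ht⟩

lemma comp_mul_mul {φ ψ y c c' c'' : ℝ → ℝ} {δ : ℝ} {s : Set ℝ}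
    (hφ : ∀ t ∈ s, HasDerivAt φ (ψ (δ * t)) (δ * t))
    (hψ : ∀ t ∈ s, HasDerivAt ψ (y (δ * t)) (δ * t))
    (hc : ∀ t, HasDerivAt c (c' t) t) (hc' : ∀ t, HasDerivAt c' (c'' t) t) :
    HasSecondDerivOn (fun t => φ (δ * t) * c t)
      (fun t => δ ^ 2 * y (δ * t) * c t + 2 * δ * ψ (δ * t) * c' t + φ (δ * t) * c'' t) s := by
  have hl : ∀ t, HasDerivAt (fun t => δ * t) δ t := fun t => by
    simpa using (hasDerivAt_id t).const_mul δ
  refine ⟨fun t => ψ (δ * t) * δ * c t + φ (δ * t) * c' t, fun t ht => ?_, fun t ht => ?_⟩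
  · exact ((hφ t ht).comp t (hl t)).mul (hc t)
  · refine ((((hψ t ht).comp t (hl t)).mul_const δ).mul (hc t)).add
      (((hφ t ht).comp t (hl t)).mul (hc' t)) |>.congr_deriv ?_
    simp only [Function.comp]
    ring

lemma convexOn {f f'' : ℝ → ℝ} {s : Set ℝ} (hs : Convex ℝ s) (h : HasSecondDerivOn f f'' s)
    (hnonneg : ∀ t ∈ s, 0 ≤ f'' t) : ConvexOn ℝ s f := by
  obtain ⟨f', h1, h2⟩ := h
  exact convexOn_of_hasDerivWithinAt2_nonneg hs
    (fun t ht => (h1 t ht).continuousAt.continuousWithinAt)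
    (fun t ht => (h1 t (interior_subset ht)).hasDerivWithinAt)
    (fun t ht => (h2 t (interior_subset ht)).hasDerivWithinAt)
    fun t ht => hnonneg t (interior_subset ht)

end HasSecondDerivOn

/-! ### Antiderivatives of weighted Gegenbauer polynomials -/

lemma hasDerivAt_one_sub_sq_rpow (x : ℝ) {p : ℝ} (h : 1 - x ^ 2 ≠ 0 ∨ 1 ≤ p) :
    HasDerivAt (fun x : ℝ => (1 - x ^ 2) ^ p) (-(2 * p) * (x * (1 - x ^ 2) ^ (p - 1))) x := by
  have hb : HasDerivAt (fun x : ℝ => 1 - x ^ 2) (-(2 * x)) x := by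
    simpa using (hasDerivAt_pow 2 x).const_sub 1
  exact (hb.rpow_const h).congr_deriv (by ring)

lemma exists_hasDerivAt_gegenR (N j : ℕ) (x : ℝ) : ∃ d, HasDerivAt (gegenR (N + 2) j) d x ∧
    (1 - x ^ 2) * d = ((N : ℝ) + 2) * (x * gegenR (N + 2) j x - gegenR N (j + 1) x) := by
  have hN : (0 : ℝ) < N + 1 := by positivity
  rcases j with _ | i
  · refine ⟨0, ?_, ?_⟩
    · have : gegenR (N + 2) 0 = fun _ => 1 := by
        ext y; simp [gegenR, gegen_zero, poch_zero]
      rw [this]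
      exact hasDerivAt_const x 1
    · simp [gegenR, gegen_zero, poch_zero, gegen_one, poch_succ]
      field_simp
      simp
  · refine ⟨_, (hasDerivAt_gegen_succ _ i x).const_mul _, ?_⟩
    have h := gegen_ode (((N : ℝ) + 1) / 2) i x
    rw [show (((N + 2 : ℕ) : ℝ) + 1) / 2 + 1 = ((N : ℝ) + 1) / 2 + 2 by push_cast; ring]
    unfold gegenR
    rw [show (((N + 2 : ℕ) : ℝ) + 1) / 2 = ((N : ℝ) + 1) / 2 + 1 by push_cast; ring,
      show ((N + 2 : ℕ) : ℝ) + 1 = (N : ℝ) + 1 + 1 + 1 by push_cast; ring,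
      poch_succ_left ((N : ℝ) + 1) (i + 1), poch_succ_left ((N : ℝ) + 1 + 1) i, poch_succ,
      Nat.factorial_succ (i + 1)]
    have hp := (poch_pos (show (0 : ℝ) < (N : ℝ) + 1 + 1 + 1 by positivity) i).ne'
    generalize gegen (((N : ℝ) + 1) / 2 + 2) i x = a at *
    generalize gegen (((N : ℝ) + 1) / 2 + 1) (i + 1) x = b at *
    generalize gegen (((N : ℝ) + 1) / 2) (i + 1 + 1) x = c at *
    have h0 : (N : ℝ) + 1 + 1 + 1 + i ≠ 0 := by positivity
    have h1 : (N : ℝ) + 1 + 1 ≠ 0 := by positivity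
    push_cast
    field_simp
    linear_combination ((N : ℝ) + 2) * h

/-- Gegenbauer polynomials weighted by `(1 - x²)^(N/2)`. -/
noncomputable def weightedGegenR (N j : ℕ) (x : ℝ) : ℝ :=
  (1 - x ^ 2) ^ ((N : ℝ) / 2) * gegenR N j x

lemma hasDerivAt_weightedGegenR (N j : ℕ) {x : ℝ} (hx : |x| < 1) :
    HasDerivAt (weightedGegenR (N + 2) j) (-((N : ℝ) + 2) * weightedGegenR N (j + 1) x) x := by
  have hpos : 0 < 1 - x ^ 2 := by
    have := (sq_lt_one_iff_abs_lt_one x).2 hx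
    linarith
  obtain ⟨d, hd, he⟩ := exists_hasDerivAt_gegenR N j x
  refine ((hasDerivAt_one_sub_sq_rpow x (Or.inl hpos.ne')).mul hd).congr_deriv ?_
  rw [show ((N + 2 : ℕ) : ℝ) / 2 = (N : ℝ) / 2 + 1 by push_cast; ring, add_sub_cancel_right,
    Real.rpow_add_one hpos.ne', weightedGegenR]
  linear_combination (1 - x ^ 2) ^ ((N : ℝ) / 2) * he

lemma weightedGegenR_add_two (N j : ℕ) {x : ℝ} (hx : |x| < 1) :
    weightedGegenR (N + 2) j x
      = (1 - x ^ 2) ^ ((N : ℝ) / 2) * (1 - x ^ 2) * gegenR (N + 2) j x := by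
  have hpos : 0 < 1 - x ^ 2 := by
    have := (sq_lt_one_iff_abs_lt_one x).2 hx
    linarith
  rw [weightedGegenR, show ((N + 2 : ℕ) : ℝ) / 2 = (N : ℝ) / 2 + 1 by push_cast; ring,
    Real.rpow_add_one hpos.ne']

/-! ### Integrals against `|s - x|` -/

lemma hasDerivAt_integral_abs_sub_mul {u : ℝ → ℝ} (hu : Continuous u) {s : ℝ} (hs : |s| < 1) :
    HasDerivAt (fun s => ∫ x in (-1 : ℝ)..1, |s - x| * u x)
      (2 * (∫ x in (-1 : ℝ)..s, u x) - ∫ x in (-1 : ℝ)..1, u x) s := by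
  have hint : ∀ {f : ℝ → ℝ}, Continuous f → ∀ a b, IntervalIntegrable f MeasureTheory.volume a b :=
    fun hf a b => hf.intervalIntegrable a b
  have hxu : Continuous fun x => x * u x := continuous_id.mul hu
  have hd : ∀ {f : ℝ → ℝ}, Continuous f → HasDerivAt (fun s => ∫ x in (-1 : ℝ)..s, f x) (f s) s :=
    fun hf => intervalIntegral.integral_hasDerivAt_right (hint hf _ _)
      hf.stronglyMeasurable.stronglyMeasurableAtFilter hf.continuousAt
  have hlin : ∀ y a b : ℝ, ∫ x in a..b, (y - x) * u x
      = y * (∫ x in a..b, u x) - ∫ x in a..b, x * u x := fun y a b => by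
    rw [← intervalIntegral.integral_const_mul, ← intervalIntegral.integral_sub
      ((hint hu _ _).const_mul _) (hint hxu _ _)]
    exact intervalIntegral.integral_congr fun x _ => by ring
  have heq : ∀ y ∈ Set.Ioo (-1 : ℝ) 1, ∫ x in (-1 : ℝ)..1, |y - x| * u x
      = 2 * (y * (∫ x in (-1 : ℝ)..y, u x) - ∫ x in (-1 : ℝ)..y, x * u x)
        - (y * (∫ x in (-1 : ℝ)..1, u x) - ∫ x in (-1 : ℝ)..1, x * u x) := by
    intro y hy
    have hc : Continuous fun x => |y - x| * u x := by fun_prop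
    have hc' : Continuous fun x => (y - x) * u x := by fun_prop
    rw [← intervalIntegral.integral_add_adjacent_intervals (hint hc (-1) y) (hint hc y 1),
      ← hlin, ← hlin,
      ← intervalIntegral.integral_add_adjacent_intervals (hint hc' (-1) y) (hint hc' y 1)]
    have h1 : ∫ x in (-1 : ℝ)..y, |y - x| * u x = ∫ x in (-1 : ℝ)..y, (y - x) * u x :=
      intervalIntegral.integral_congr fun x hx => by
        rw [Set.uIcc_of_le hy.1.le] at hx
        simp only [abs_of_nonneg (sub_nonneg.2 hx.2)]
    have h2 : ∫ x in y..1, |y - x| * u x = -∫ x in y..1, (y - x) * u x := by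
      rw [← intervalIntegral.integral_neg]
      exact intervalIntegral.integral_congr fun x hx => by
        rw [Set.uIcc_of_le hy.2.le] at hx
        simp only [abs_of_nonpos (sub_nonpos.2 hx.1), neg_mul]
    rw [h1, h2]
    ring
  have key := (((((hasDerivAt_id s).mul (hd hu)).sub (hd hxu)).const_mul 2).sub
    (((hasDerivAt_id s).mul_const (∫ x in (-1 : ℝ)..1, u x)).sub_const
      (∫ x in (-1 : ℝ)..1, x * u x)))
  refine (key.congr_of_eventuallyEq ?_).congr_deriv ?_
  · filter_upwards [Ioo_mem_nhds (abs_lt.1 hs).1 (abs_lt.1 hs).2] with y hy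
    simpa using heq y hy
  · simp only [id]
    ring

lemma hasDerivAt_two_mul_integral_sub {u : ℝ → ℝ} (hu : Continuous u) (c s : ℝ) :
    HasDerivAt (fun s => 2 * (∫ x in (-1 : ℝ)..s, u x) - c) (2 * u s) s :=
  ((intervalIntegral.integral_hasDerivAt_right (hu.intervalIntegrable _ _)
    hu.stronglyMeasurable.stronglyMeasurableAtFilter hu.continuousAt).const_mul 2).sub_const c

lemma continuous_one_sub_sq_rpow {p : ℝ} (hp : 0 ≤ p) :
    Continuous fun x : ℝ => (1 - x ^ 2) ^ p :=
  (by fun_prop : Continuous fun x : ℝ => 1 - x ^ 2).rpow_const fun _ => Or.inr hp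

lemma integral_mul_one_sub_sq_rpow (M : ℕ) (s : ℝ) :
    ∫ x in (-1 : ℝ)..s, (1 - x ^ 2) ^ ((M : ℝ) / 2) * x
      = -(1 / ((M : ℝ) + 2)) * (1 - s ^ 2) ^ ((M : ℝ) / 2 + 1) := by
  have hM : (0 : ℝ) ≤ (M : ℝ) / 2 := by positivity
  have hd : ∀ x : ℝ, HasDerivAt (fun x : ℝ => -(1 / ((M : ℝ) + 2)) * (1 - x ^ 2) ^ ((M : ℝ) / 2 + 1))
      ((1 - x ^ 2) ^ ((M : ℝ) / 2) * x) x := fun x => by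
    refine ((hasDerivAt_one_sub_sq_rpow x (Or.inr (by linarith))).const_mul _).congr_deriv ?_
    rw [add_sub_cancel_right]
    field_simp
  rw [intervalIntegral.integral_eq_sub_of_hasDerivAt (fun x _ => hd x)
    (((continuous_one_sub_sq_rpow hM).mul continuous_id).intervalIntegrable _ _)]
  have : (M : ℝ) / 2 + 1 ≠ 0 := by positivity
  simp [Real.zero_rpow this]

lemma weightedGegenR_zero (N : ℕ) (x : ℝ) : weightedGegenR N 0 x = (1 - x ^ 2) ^ ((N : ℝ) / 2) := by
  simp [weightedGegenR, gegenR, gegen_zero, poch_zero]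

lemma weightedGegenR_one (N : ℕ) (x : ℝ) :
    weightedGegenR N 1 x = (1 - x ^ 2) ^ ((N : ℝ) / 2) * x := by
  have : (N : ℝ) + 1 ≠ 0 := by positivity
  simp [weightedGegenR, gegenR, gegen_one, poch_succ, poch_zero]
  field_simp
  simp

lemma hasDerivAt_integral_abs_sub_mul_weight (M : ℕ) {s : ℝ} (hs : |s| < 1) :
    HasDerivAt (fun s => ∫ x in (-1 : ℝ)..1, |s - x| * ((1 - x ^ 2) ^ ((M : ℝ) / 2) * x))
      (-(2 / ((M : ℝ) + 2)) * weightedGegenR (M + 2) 0 s) s := by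
  have hc : Continuous fun x : ℝ => (1 - x ^ 2) ^ ((M : ℝ) / 2) * x :=
    (continuous_one_sub_sq_rpow (by positivity)).mul continuous_id
  refine (hasDerivAt_integral_abs_sub_mul hc hs).congr_deriv ?_
  have h0 : (M : ℝ) / 2 + 1 ≠ 0 := by positivity
  rw [integral_mul_one_sub_sq_rpow, integral_mul_one_sub_sq_rpow, weightedGegenR_zero,
    show ((M + 2 : ℕ) : ℝ) / 2 = (M : ℝ) / 2 + 1 by push_cast; ring]
  simp [Real.zero_rpow h0]
  ring

/-! ### Convexity -/

/-- A partial sum of the convex function, in normalized form. -/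
noncomputable def convexPartial (M : ℕ) (ρ δ : ℝ) (m : ℕ) (t : ℝ) : ℝ :=
  (∫ x in (-1 : ℝ)..1, |δ * t - x| * (1 - x ^ 2) ^ ((M : ℝ) / 2)) * 1
    + (∫ x in (-1 : ℝ)..1, |δ * t - x| * ((1 - x ^ 2) ^ ((M : ℝ) / 2) * x))
      * (((M : ℝ) + 1) * ρ * t)
    + ∑ k ∈ Finset.range m, weightedGegenR (M + 4) k (δ * t)
      * (2 / (((M : ℝ) + 2) * (M + 4)) * ρ ^ (k + 2) * gegen (((M : ℝ) + 1) / 2) (k + 2) t)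

/-- A partial sum of the bilinear generating function. -/
noncomputable def gegenKernelPartial (N m : ℕ) (ρ s t : ℝ) : ℝ :=
  ∑ k ∈ Finset.range m, gegenR N k s * gegen (((N : ℝ) + 1) / 2) k t * ρ ^ k

lemma hasSecondDerivOn_convexPartial (M : ℕ) {ρ δ : ℝ} (hδ : |δ| < 1) (m : ℕ) :
    HasSecondDerivOn (convexPartial M ρ δ m)
      (fun t => 2 * (1 - (δ * t) ^ 2) ^ ((M : ℝ) / 2) *
        (δ ^ 2 * gegenKernelPartial M (m + 2) ρ (δ * t) t
          - 2 * δ * (ρ * (1 - (δ * t) ^ 2)) * (((M : ℝ) + 1) / (M + 2))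
            * gegenKernelPartial (M + 2) (m + 1) ρ (δ * t) t
          + (ρ * (1 - (δ * t) ^ 2)) ^ 2 * (((M : ℝ) + 1) * (M + 3) / ((M + 2) * (M + 4)))
            * gegenKernelPartial (M + 4) m ρ (δ * t) t)) (Set.Icc (-1) 1) := by
  have hlt : ∀ t ∈ Set.Icc (-1 : ℝ) 1, |δ * t| < 1 := fun t ht => by
    rw [abs_mul]
    exact (mul_le_of_le_one_right (abs_nonneg δ) (abs_le.2 ht)).trans_lt hδ
  have hw : Continuous fun x : ℝ => (1 - x ^ 2) ^ ((M : ℝ) / 2) :=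
    continuous_one_sub_sq_rpow (by positivity)
  have hF := HasSecondDerivOn.comp_mul_mul (δ := δ) (s := Set.Icc (-1) 1)
    (ψ := fun s => 2 * (∫ x in (-1 : ℝ)..s, (1 - x ^ 2) ^ ((M : ℝ) / 2))
      - ∫ x in (-1 : ℝ)..1, (1 - x ^ 2) ^ ((M : ℝ) / 2))
    (y := fun s => 2 * (1 - s ^ 2) ^ ((M : ℝ) / 2))
    (fun t ht => hasDerivAt_integral_abs_sub_mul hw (hlt t ht))
    (fun t _ => hasDerivAt_two_mul_integral_sub hw _ _)
    (fun t => hasDerivAt_const t (1 : ℝ)) (fun t => hasDerivAt_const t (0 : ℝ))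
  have hG := HasSecondDerivOn.comp_mul_mul (δ := δ) (s := Set.Icc (-1) 1)
    (fun t ht => hasDerivAt_integral_abs_sub_mul_weight M (hlt t ht))
    (y := fun s => -(2 / ((M : ℝ) + 2)) * (-((M : ℝ) + 2) * weightedGegenR M 1 s))
    (fun t ht => (hasDerivAt_weightedGegenR M 0 (hlt t ht)).const_mul _)
    (fun t => (hasDerivAt_id t).const_mul (((M : ℝ) + 1) * ρ))
    (fun t => hasDerivAt_const t _)
  have hH := HasSecondDerivOn.sum (s := Set.Icc (-1) 1) (A := Finset.range m) fun k =>
    HasSecondDerivOn.comp_mul_mul (δ := δ) (s := Set.Icc (-1) 1)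
    (fun t ht => hasDerivAt_weightedGegenR (M + 2) k (hlt t ht))
    (y := fun s => -(((M + 2 : ℕ) : ℝ) + 2) * (-((M : ℝ) + 2) * weightedGegenR M (k + 2) s))
    (fun t ht => (hasDerivAt_weightedGegenR M (k + 1) (hlt t ht)).const_mul _)
    (fun t => (hasDerivAt_gegen_succ (((M : ℝ) + 1) / 2) (k + 1) t).const_mul
      (2 / (((M : ℝ) + 2) * (M + 4)) * ρ ^ (k + 2)))
    (fun t => ((hasDerivAt_gegen_succ (((M : ℝ) + 1) / 2 + 1) k t).const_mul _).const_mul _)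
  obtain ⟨f', h1, h2⟩ := (hF.add hG).add hH
  refine ⟨f', h1, fun t ht => (h2 t ht).congr_deriv ?_⟩
  have hs := hlt t ht
  simp only [gegenKernelPartial, weightedGegenR_add_two _ _ hs, weightedGegenR_one]
  simp only [weightedGegenR]
  have hpos : 0 < 1 - (δ * t) ^ 2 := by
    have := (sq_lt_one_iff_abs_lt_one _).2 hs
    linarith
  rw [Finset.sum_range_succ' _ (m + 1), Finset.sum_range_succ' _ m, Finset.sum_range_succ' _ m,
    show (1 - (δ * t) ^ 2) ^ (((M + 2 : ℕ) : ℝ) / 2)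
      = (1 - (δ * t) ^ 2) ^ ((M : ℝ) / 2) * (1 - (δ * t) ^ 2) by
        rw [← Real.rpow_add_one hpos.ne']; push_cast; ring_nf,
    show (((M + 2 : ℕ) : ℝ) + 1) / 2 = ((M : ℝ) + 1) / 2 + 1 by push_cast; ring,
    show (((M + 4 : ℕ) : ℝ) + 1) / 2 = ((M : ℝ) + 1) / 2 + 1 + 1 by push_cast; ring]
  generalize (1 - (δ * t) ^ 2) ^ ((M : ℝ) / 2) = w
  generalize 1 - (δ * t) ^ 2 = a
  have hterm : ∀ k, δ ^ 2 * (-(((M + 2 : ℕ) : ℝ) + 2) * (-((M : ℝ) + 2)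
          * (w * gegenR M (k + 2) (δ * t))))
        * (2 / (((M : ℝ) + 2) * (M + 4)) * ρ ^ (k + 2) * gegen (((M : ℝ) + 1) / 2) (k + 2) t)
      + 2 * δ * (-(((M + 2 : ℕ) : ℝ) + 2) * (w * a * gegenR (M + 2) (k + 1) (δ * t)))
        * (2 / (((M : ℝ) + 2) * (M + 4)) * ρ ^ (k + 2)
          * (2 * (((M : ℝ) + 1) / 2) * gegen (((M : ℝ) + 1) / 2 + 1) (k + 1) t))
      + w * a * a * gegenR (M + 4) k (δ * t)
        * (2 / (((M : ℝ) + 2) * (M + 4)) * ρ ^ (k + 2) * (2 * (((M : ℝ) + 1) / 2)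
          * (2 * (((M : ℝ) + 1) / 2 + 1) * gegen (((M : ℝ) + 1) / 2 + 1 + 1) k t)))
      = 2 * w * δ ^ 2 * (gegenR M (k + 2) (δ * t) * gegen (((M : ℝ) + 1) / 2) (k + 2) t
          * ρ ^ (k + 2))
        - 2 * w * (2 * δ * (ρ * a) * (((M : ℝ) + 1) / (M + 2)))
          * (gegenR (M + 2) (k + 1) (δ * t) * gegen (((M : ℝ) + 1) / 2 + 1) (k + 1) t
            * ρ ^ (k + 1))
        + 2 * w * ((ρ * a) ^ 2 * (((M : ℝ) + 1) * (M + 3) / ((M + 2) * (M + 4))))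
          * (gegenR (M + 4) k (δ * t) * gegen (((M : ℝ) + 1) / 2 + 1 + 1) k t * ρ ^ k) := by
    intro k
    push_cast
    field_simp
    ring
  have hM1 : (M : ℝ) + 1 ≠ 0 := by positivity
  have hM2 : (M : ℝ) + 2 ≠ 0 := by positivity
  have h1' : gegenR M 1 (δ * t) = δ * t := by
    simp [gegenR, gegen_one, poch_succ, poch_zero]; field_simp
  have h0' : ∀ N, gegenR N 0 (δ * t) = 1 := fun N => by
    simp [gegenR, gegen_zero, poch_zero]
  rw [Finset.sum_congr rfl fun k _ => hterm k, Finset.sum_add_distrib, Finset.sum_sub_distrib,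
    ← Finset.mul_sum, ← Finset.mul_sum, ← Finset.mul_sum]
  simp only [h1', h0', gegen_zero, gegen_one, zero_add, id]
  field_simp
  ring

/-- The amount of convexity missing from `convexPartial` because of truncation. -/
noncomputable def convexDefect (M : ℕ) (ρ : ℝ) (m : ℕ) : ℝ :=
  gegenTail M ρ (m + 2) + 2 * gegenTail (M + 2) ρ (m + 1) + gegenTail (M + 4) ρ m

lemma tendsto_convexDefect (M : ℕ) (ρ : ℝ) :
    Filter.Tendsto (convexDefect M ρ) Filter.atTop (nhds 0) := by
  have := (((tendsto_gegenTail M ρ).comp (Filter.tendsto_add_atTop_nat 2)).add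
    (((tendsto_gegenTail (M + 2) ρ).comp (Filter.tendsto_add_atTop_nat 1)).const_mul 2)).add
    (tendsto_gegenTail (M + 4) ρ)
  simp only [mul_zero, add_zero] at this
  exact this

lemma convexOn_convexPartial_add (M : ℕ) {ρ δ : ℝ} (hρ0 : 0 ≤ ρ) (hρ : ρ < 1) (hδ : |δ| < 1)
    (m : ℕ) : ConvexOn ℝ (Set.Icc (-1) 1)
      fun t => convexPartial M ρ δ m t + convexDefect M ρ m * t ^ 2 := by
  have hsq : HasSecondDerivOn (fun t => convexDefect M ρ m * t ^ 2)
      (fun _ => 2 * convexDefect M ρ m) (Set.Icc (-1) 1) := by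
    refine ⟨fun t => convexDefect M ρ m * (2 * t), fun t _ => ?_, fun t _ => ?_⟩
    · simpa using (hasDerivAt_pow 2 t).const_mul (convexDefect M ρ m)
    · exact (((hasDerivAt_id t).const_mul 2).const_mul (convexDefect M ρ m)).congr_deriv (by ring)
  refine ((hasSecondDerivOn_convexPartial M hδ m).add hsq).convexOn (convex_Icc _ _)
    fun t ht => ?_
  have ht' : |t| ≤ 1 := abs_le.2 ht
  have hs : |δ * t| ≤ 1 := by
    rw [abs_mul]; exact mul_le_one₀ hδ.le (abs_nonneg t) ht'
  have ha0 : 0 ≤ 1 - (δ * t) ^ 2 := by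
    have := (sq_le_one_iff_abs_le_one _).2 hs
    linarith
  have ha1 : 1 - (δ * t) ^ 2 ≤ 1 := by linarith [sq_nonneg (δ * t)]
  have hQ := gegenKernel_quadratic_nonneg M hs ht' (by rwa [abs_of_nonneg hρ0]) δ
    (ρ * (1 - (δ * t) ^ 2))
  have hA := abs_gegenKernel_sub_sum_le M (m + 2) hs ht' hρ0 hρ
  have hB := abs_gegenKernel_sub_sum_le (M + 2) (m + 1) hs ht' hρ0 hρ
  have hD := abs_gegenKernel_sub_sum_le (M + 4) m hs ht' hρ0 hρ
  have hw0 : 0 ≤ (1 - (δ * t) ^ 2) ^ ((M : ℝ) / 2) := Real.rpow_nonneg ha0 _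
  have hw1 : (1 - (δ * t) ^ 2) ^ ((M : ℝ) / 2) ≤ 1 := Real.rpow_le_one ha0 ha1 (by positivity)
  have hq0 : 0 ≤ ρ * (1 - (δ * t) ^ 2) := mul_nonneg hρ0 ha0
  have hq1 : ρ * (1 - (δ * t) ^ 2) ≤ 1 := mul_le_one₀ hρ.le ha0 ha1
  have hc1 : |δ ^ 2| ≤ 1 := by
    rw [abs_pow]; exact pow_le_one₀ (abs_nonneg _) hδ.le
  have hκ1 : |((M : ℝ) + 1) / (M + 2)| ≤ 1 := by
    rw [abs_of_nonneg (by positivity), div_le_one (by positivity)]; linarith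
  have hκ2 : |((M : ℝ) + 1) * (M + 3) / ((M + 2) * (M + 4))| ≤ 1 := by
    rw [abs_of_nonneg (by positivity), div_le_one (by positivity)]
    nlinarith [(Nat.cast_nonneg M : (0 : ℝ) ≤ M)]
  have hq : |ρ * (1 - (δ * t) ^ 2)| ≤ 1 := by rwa [abs_of_nonneg hq0]
  have hc2 : |2 * δ * (ρ * (1 - (δ * t) ^ 2)) * (((M : ℝ) + 1) / (M + 2))| ≤ 2 := by
    rw [mul_assoc 2, mul_assoc, abs_mul, abs_mul, abs_mul, abs_two]
    have := mul_le_one₀ (mul_le_one₀ hδ.le (abs_nonneg _) hq) (abs_nonneg _) hκ1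
    linarith
  have hc3 : |(ρ * (1 - (δ * t) ^ 2)) ^ 2 * (((M : ℝ) + 1) * (M + 3) / ((M + 2) * (M + 4)))|
      ≤ 1 := by
    rw [abs_mul, abs_pow]
    exact mul_le_one₀ (pow_le_one₀ (abs_nonneg _) hq) (abs_nonneg _) hκ2
  simp only [convexDefect, gegenKernelPartial]
  generalize (1 - (δ * t) ^ 2) ^ ((M : ℝ) / 2) = w at *
  generalize δ ^ 2 = c₁ at *
  generalize 2 * δ * (ρ * (1 - (δ * t) ^ 2)) * (((M : ℝ) + 1) / (M + 2)) = c₂ at *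
  generalize (ρ * (1 - (δ * t) ^ 2)) ^ 2
    * (((M : ℝ) + 1) * (M + 3) / ((M + 2) * (M + 4))) = c₃ at *
  have key : ∀ {c P S T b : ℝ}, |c| ≤ b → |P - S| ≤ T → |c * (P - S)| ≤ b * T :=
    fun hc hP => by
      rw [abs_mul]; exact mul_le_mul hc hP (abs_nonneg _) ((abs_nonneg _).trans hc)
  have k1 := abs_le.1 (key hc1 hA)
  have k2 := abs_le.1 (key hc2 hB)
  have k3 := abs_le.1 (key hc3 hD)
  have t1 := (abs_nonneg _).trans hA
  have t2 := (abs_nonneg _).trans hB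
  have t3 := (abs_nonneg _).trans hD
  generalize gegenTail M ρ (m + 2) = τ₁ at *
  generalize gegenTail (M + 2) ρ (m + 1) = τ₂ at *
  generalize gegenTail (M + 4) ρ m = τ₃ at *
  have hτ : w * (τ₁ + 2 * τ₂ + τ₃) ≤ τ₁ + 2 * τ₂ + τ₃ :=
    mul_le_of_le_one_left (by positivity) hw1
  rw [mul_assoc 2 w]
  refine le_trans ?_ (add_le_add (mul_le_mul_of_nonneg_left (mul_le_mul_of_nonneg_left
    (?_ : -(τ₁ + 2 * τ₂ + τ₃) ≤ _) hw0) zero_le_two) le_rfl)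
  · linarith
  · linarith

lemma tendsto_convexPartial (M : ℕ) {ρ δ t : ℝ} (hρ0 : 0 ≤ ρ) (hρ : ρ < 1) (hs : |δ * t| ≤ 1)
    (ht : |t| ≤ 1) : Filter.Tendsto (fun m => convexPartial M ρ δ m t) Filter.atTop
      (nhds ((∫ x in (-1 : ℝ)..1, |δ * t - x| * (1 - x ^ 2) ^ ((M : ℝ) / 2)) * 1
        + (∫ x in (-1 : ℝ)..1, |δ * t - x| * ((1 - x ^ 2) ^ ((M : ℝ) / 2) * x))
          * (((M : ℝ) + 1) * ρ * t)
        + 2 / (((M : ℝ) + 2) * (M + 4)) * (1 - (δ * t) ^ 2) ^ (((M + 4 : ℕ) : ℝ) / 2)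
          * ∑' k : ℕ, gegenR (M + 4) k (δ * t) * gegen (((M : ℝ) + 1) / 2) (k + 2) t
            * ρ ^ (k + 2))) := by
  have hsum : Summable fun k : ℕ => gegenR (M + 4) k (δ * t)
      * gegen (((M : ℝ) + 1) / 2) (k + 2) t * ρ ^ (k + 2) := by
    refine ((summable_nat_add_iff 2).2 (summable_poch_div_factorial
      (a := 2 * (((M : ℝ) + 1) / 2)) (by positivity) hρ0 hρ)).of_norm_bounded fun k => ?_
    rw [mul_assoc, norm_mul]
    exact (mul_le_of_le_one_left (norm_nonneg _) (abs_gegenR_le _ k hs)).trans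
      (abs_gegen_mul_pow_le (by positivity) (k + 2) ht (abs_of_nonneg hρ0).le)
  refine ((hsum.hasSum.mul_left (2 / (((M : ℝ) + 2) * (M + 4))
    * (1 - (δ * t) ^ 2) ^ (((M + 4 : ℕ) : ℝ) / 2))).tendsto_sum_nat.const_add _).congr fun m => ?_
  rw [convexPartial]
  congr 1
  refine Finset.sum_congr rfl fun k _ => ?_
  rw [weightedGegenR]
  ring

theorem convexity_FGH (n : ℕ) (hn : 3 ≤ n) (ρ δ : ℝ)
    (hρ : 0 < ρ) (hρ' : ρ < 1) (hδ : δ = ((n:ℝ) - 2)/(n:ℝ) * ρ)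
    (F G H : ℝ → ℝ)
    (hF : ∀ t : ℝ, F t = ∫ x in (-1:ℝ)..1, |δ*t - x| * (1 - x^2) ^ (((n:ℝ) - 3)/2))
    (hG : ∀ t : ℝ, G t = ((n:ℝ) - 2)*ρ*t
        * ∫ x in (-1:ℝ)..1, |δ*t - x| * (1 - x^2) ^ (((n:ℝ) - 3)/2) * x)
    (hH : ∀ t : ℝ, H t = 2/((n:ℝ)^2 - 1) * (1 - δ^2*t^2) ^ (((n:ℝ) + 1)/2)
        * ∑' k : ℕ, (Nat.factorial k : ℝ) / poch ((n:ℝ) + 2) k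
            * gegen (((n:ℝ) + 2)/2) k (δ*t) * gegen (((n:ℝ) - 2)/2) (k + 2) t * ρ^(k + 2)) :
    ConvexOn ℝ (Set.Icc (-1:ℝ) 1) (fun t => F t + G t + H t) := by
  obtain ⟨M, rfl⟩ := Nat.exists_eq_add_of_le' hn
  have hδ1 : |δ| < 1 := by
    have hM : (0 : ℝ) ≤ (((M + 3 : ℕ) : ℝ) - 2) / ((M + 3 : ℕ) : ℝ) := by
      apply div_nonneg _ (by positivity)
      push_cast; linarith [(Nat.cast_nonneg M : (0 : ℝ) ≤ M)]
    have hM1 : (((M + 3 : ℕ) : ℝ) - 2) / ((M + 3 : ℕ) : ℝ) ≤ 1 := by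
      rw [div_le_one (by positivity)]; linarith
    rw [hδ, abs_of_nonneg (mul_nonneg hM hρ.le)]
    exact (mul_le_of_le_one_left hρ.le hM1).trans_lt hρ'
  have hlim : ∀ t ∈ Set.Icc (-1 : ℝ) 1, Filter.Tendsto
      (fun m => convexPartial M ρ δ m t + convexDefect M ρ m * t ^ 2) Filter.atTop
      (nhds (F t + G t + H t)) := by
    intro t ht
    have ht' : |t| ≤ 1 := abs_le.2 ht
    have hs : |δ * t| ≤ 1 := by
      rw [abs_mul]; exact mul_le_one₀ hδ1.le (abs_nonneg t) ht'
    have h := (tendsto_convexPartial M hρ.le hρ' hs ht').add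
      ((tendsto_convexDefect M ρ).mul_const (t ^ 2))
    have e : ∀ x, |δ * t - x| * (1 - x ^ 2) ^ ((M : ℝ) / 2) * x
        = |δ * t - x| * ((1 - x ^ 2) ^ ((M : ℝ) / 2) * x) := fun x => mul_assoc _ _ _
    rw [zero_mul, add_zero] at h
    convert h using 2
    rw [hF, hG, hH, mul_one, show (((M + 3 : ℕ) : ℝ) - 3) / 2 = (M : ℝ) / 2 by push_cast; ring,
      show ((M + 3 : ℕ) : ℝ) - 2 = (M : ℝ) + 1 by push_cast; ring,
      show ((M + 3 : ℕ) : ℝ) ^ 2 - 1 = ((M : ℝ) + 2) * (M + 4) by push_cast; ring,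
      show (((M + 3 : ℕ) : ℝ) + 1) / 2 = ((M + 4 : ℕ) : ℝ) / 2 by push_cast; ring,
      show ((M + 3 : ℕ) : ℝ) + 2 = ((M + 4 : ℕ) : ℝ) + 1 by push_cast; ring, mul_pow]
    simp only [e, gegenR]
    ring
  refine ⟨convex_Icc _ _, fun x hx y hy a b ha hb hab => ?_⟩
  exact le_of_tendsto_of_tendsto' (hlim _ (convex_Icc (-1 : ℝ) 1 hx hy ha hb hab))
    (((hlim x hx).const_smul a).add ((hlim y hy).const_smul b))
    fun m => (convexOn_convexPartial_add M hρ.le hρ' hδ1 m).2 hx hy ha hb hab
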